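/- arXiv:1008.3921 — 4 statements merged into one kernel-verified Lean document; each statement's English description precedes it below -/
import Mathlib

section
/- Let n ∈ ℤ be nonzero, c ∈ O_K nonzero, and (x,m) ∈ X(c,n) (so in particular D | n). Let x̄ ∈ O_K satisfy x·x̄ ≡ 1 (mod c). Then r := (n·x̄ − δ'c')/(δc) lies in O_K, satisfies r·r' ≡ 1 (mod n), and x̄ = (δc·r + δ'c')/n. The class of r modulo n/δ (note n/δ = (n/D)√D ∈ O_K) depends only on the equivalence class of (x,m) in X(c,n) and not on the choice of x̄, and the resulting map from X(c,n) to O_K/(n/δ) is injective. -/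
/-- If the fixed points of `σ` are the integers and `σ δ = -δ` with `δ ^ 2 = D` prime, then `δ`
divides every difference `z - σ z`. -/
theorem sqrt_prime_dvd_sub_conj {R : Type*} [CommRing R] [IsDomain R] [CharZero R]
    {D : ℕ} (hD : Nat.Prime D) {σ : R ≃+* R} (hσσ : ∀ y : R, σ (σ y) = y)
    (hfix : ∀ y : R, σ y = y → ∃ k : ℤ, y = (k : R))
    {δ : R} (hδ2 : δ ^ 2 = (D : R)) (hσδ : σ δ = -δ) (z : R) : δ ∣ z - σ z := by
  have hδ : δ ≠ 0 := by
    rintro rfl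
    exact hD.ne_zero (by exact_mod_cast (by simpa using hδ2.symm : (D : R) = 0))
  obtain ⟨k, hk⟩ := hfix (δ * (z - σ z)) (by rw [map_mul, map_sub, hσσ, hσδ]; ring)
  obtain ⟨j, hj⟩ := hfix ((z - σ z) ^ 2) (by rw [map_pow, map_sub, hσσ]; ring)
  have hkj : k ^ 2 = D * j := by
    have : ((k ^ 2 : ℤ) : R) = ((D * j : ℤ) : R) := by
      push_cast
      rw [← hk, ← hj, ← hδ2]
      ring
    exact_mod_cast this
  obtain ⟨l, rfl⟩ : (D : ℤ) ∣ k :=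
    (Nat.prime_iff_prime_int.mp hD).dvd_of_dvd_pow ⟨j, hkj⟩
  refine ⟨(l : R), mul_left_cancel₀ hδ ?_⟩
  rw [hk]
  push_cast
  rw [← hδ2]
  ring

/-- Inverses modulo `c` of congruent elements are congruent. -/
theorem dvd_sub_of_dvd_mul_sub_one {R : Type*} [CommRing R] {c x y u v : R}
    (hxu : c ∣ x * u - 1) (hyv : c ∣ y * v - 1) (hxy : c ∣ x - y) : c ∣ u - v := by
  have h : u - v = v * (x * u - 1) - u * (y * v - 1) - u * v * (x - y) := by ring
  rw [h]
  exact ((hxu.mul_left _).sub (hyv.mul_left _)).sub (hxy.mul_left _)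


/-- Model of the ring of integers `R = O_K` of `K = ℚ(√D)` (`D ≡ 1 (mod 4)`
prime, class number one): `R` is a principal ideal domain with an injective real embedding
`emb`, an involution `σ ≠ id` (Galois conjugation `x ↦ x'`) whose fixed ring is exactly `ℤ`,
`δ² = D`, `σ δ = −δ`, and `(1+δ)/2 ∈ R`.

Let `n ∈ ℤ` be nonzero, `c ≠ 0`, and `(x,m) ∈ X(c,n)`, i.e. `x` is coprime to `c`, `m ∈ ℤ`
and `δ'c'x + δcx' = n − m·N(δc)` (so in particular `D ∣ n`).  Let `x̄` satisfy
`x·x̄ ≡ 1 (mod c)`.  Then `r := (n·x̄ − δ'c')/(δc)` lies in `R`, satisfies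
`r·r' ≡ 1 (mod n)` and `x̄ = (δc·r + δ'c')/n`; the class of `r` modulo
`n/δ = (n/D)·δ` depends only on the equivalence class of `(x,m)` (and not on the choice of
`x̄`), and the resulting map from `X(c,n)` to `O_K/(n/δ)` is injective. -/
theorem stmt_2
    (D : ℕ) (hD : Nat.Prime D) (hD4 : D % 4 = 1)
    (R : Type) [CommRing R] [IsDomain R] [IsPrincipalIdealRing R]
    (emb : R →+* ℝ) (hemb : Function.Injective emb)
    (σ : R ≃+* R) (hσσ : ∀ y : R, σ (σ y) = y) (hσne : σ ≠ RingEquiv.refl R)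
    (hfix : ∀ y : R, σ y = y ↔ ∃ k : ℤ, y = (k : R))
    (δ : R) (hδ2 : δ ^ 2 = (D : R)) (hσδ : σ δ = -δ)
    (hhalf : ∃ ω : R, 2 * ω = 1 + δ)
    (n : ℤ) (hn : n ≠ 0) (hDn : (D : ℤ) ∣ n)
    (c : R) (hc : c ≠ 0)
    (x : R) (m : ℤ) (hx : IsCoprime x c)
    (heq : σ δ * σ c * x + δ * c * σ x = (n : R) - (m : R) * ((δ * c) * σ (δ * c)))
    (xb : R) (hxb : c ∣ x * xb - 1) :
    ∃ r : R,
      δ * c * r = (n : R) * xb - σ δ * σ c ∧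
      (n : R) ∣ r * σ r - 1 ∧
      (n : R) * xb = δ * c * r + σ δ * σ c ∧
      ∀ (y : R) (m' : ℤ) (yb r' : R),
        IsCoprime y c →
        σ δ * σ c * y + δ * c * σ y = (n : R) - (m' : R) * ((δ * c) * σ (δ * c)) →
        c ∣ y * yb - 1 →
        δ * c * r' = (n : R) * yb - σ δ * σ c →
        ((c ∣ x - y → ((n / (D : ℤ) : ℤ) : R) * δ ∣ r - r') ∧
         (((n / (D : ℤ) : ℤ) : R) * δ ∣ r - r' → c ∣ x - y)) := by
  have : CharZero R := ⟨fun a b h => by simpa using congrArg emb h⟩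
  have hn0 : (n : R) ≠ 0 := Int.cast_ne_zero.mpr hn
  have hδ : δ ≠ 0 := by
    rintro rfl
    exact hD.ne_zero (by exact_mod_cast (by simpa using hδ2.symm : (D : R) = 0))
  have hσc : σ c ≠ 0 := by simpa using hc
  obtain ⟨t, ht⟩ := hxb
  have hσt : σ x * σ xb - 1 = σ c * σ t := by
    simpa using congrArg σ ht
  simp only [map_mul, hσδ] at heq ⊢
  obtain ⟨r, hr⟩ : ∃ r : R, δ * c * r = (n : R) * xb - -δ * σ c :=
    ⟨-σ c * t + σ x * xb - m * δ * σ c * xb,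
      by linear_combination xb * heq + δ * σ c * ht⟩
  have hσr : -δ * σ c * σ r = (n : R) * σ xb - δ * c := by
    have h := congrArg σ hr
    simp only [map_mul, map_sub, map_neg, map_intCast, hσδ, hσσ] at h
    linear_combination h
  refine ⟨r, hr, ?_, by linear_combination -hr, ?_⟩
  · obtain ⟨w, hw⟩ := sqrt_prime_dvd_sub_conj hD hσσ (fun y => (hfix y).mp) hδ2 hσδ (xb * σ t)
    rw [map_mul, hσσ] at hw
    refine ⟨m * xb * σ xb - w, mul_left_cancel₀ (mul_ne_zero (mul_ne_zero hδ hc)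
      (mul_ne_zero hδ hσc)) ?_⟩
    linear_combination δ * σ c * σ r * hr - (n * xb + δ * σ c) * hσr + n * xb * σ xb * heq
      + n * (δ * σ c * σ xb * ht - δ * c * xb * hσt - δ * c * σ c * hw)
  · intro y m' yb r' _ _ hyb hr'
    obtain ⟨k, rfl⟩ := hDn
    have hD0 : (D : ℤ) ≠ 0 := by exact_mod_cast hD.ne_zero
    rw [Int.mul_ediv_cancel_left _ hD0]
    push_cast at hr hr' hn0
    rw [← hδ2] at hr hr' hn0
    have hxb : c ∣ x * xb - 1 := ⟨t, ht⟩
    constructor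
    · intro hxy
      obtain ⟨s, hs⟩ := dvd_sub_of_dvd_mul_sub_one hxb hyb hxy
      refine ⟨s, mul_left_cancel₀ (mul_ne_zero hδ hc) ?_⟩
      linear_combination hr - hr' + δ ^ 2 * k * hs
    · rintro ⟨s, hs⟩
      rw [mul_comm] at hxb hyb
      refine dvd_sub_of_dvd_mul_sub_one hxb hyb ⟨s, mul_left_cancel₀ hn0 ?_⟩
      linear_combination hr' - hr + δ * c * hs
end

section
/- For positive integers d | n define R(n,d) := (1/(d·n)) · Σ_{a | d} (μ(a)/a) · Π_{p prime, p | (n·a/d)} (1 + 1/p)^{−1}, where μ is the Möbius function. Then Σ_{d | n} R(n,d) = 1/n. -/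
/-- `R(n,d) = (1/(d·n)) · Σ_{a | d} (μ(a)/a) · Π_{p prime, p | (n·a/d)} (1 + 1/p)⁻¹`,
where the sum is over the positive divisors of `d` and the product over the
rational primes dividing `n·a/d`. -/
noncomputable def Rnd (n d : ℕ) : ℚ :=
  (1 / ((d : ℚ) * (n : ℚ))) *
    ∑ a ∈ d.divisors, ((ArithmeticFunction.moebius a : ℚ) / (a : ℚ)) *
      ∏ p ∈ (n * a / d).primeFactors, ((1 : ℚ) + 1 / (p : ℚ))⁻¹

open UniqueFactorizationMonoid in
/-- The divisor sum of `μ · f` as an Euler product, for a multiplicative function `f`. -/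
theorem sum_divisors_moebius_mul_eq_prod_primeFactors {R : Type*} [CommRing R]
    {f : ArithmeticFunction R} (hf : f.IsMultiplicative) {n : ℕ} (hn : n ≠ 0) :
    ∑ d ∈ n.divisors, (ArithmeticFunction.moebius d : R) * f d =
      ∏ p ∈ n.primeFactors, (1 - f p) := by
  rw [← Nat.primeFactors_radical n, hf.prodPrimeFactors_one_sub_of_squarefree f squarefree_radical]
  refine (Finset.sum_subset (Nat.divisors_subset_of_dvd hn radical_dvd_self) ?_).symm
  intro d hd hd'
  have hsq : ¬ Squarefree d := fun h => hd' <| Nat.mem_divisors.2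
    ⟨(dvd_radical_iff h.isRadical hn).2 (Nat.dvd_of_mem_divisors hd), radical_ne_zero⟩
  simp [ArithmeticFunction.moebius_eq_zero_of_not_squarefree hsq]

/-- `Σ_{a | m} μ(a)/a²` as an Euler product. -/
theorem sum_divisors_moebius_div_sq {m : ℕ} (hm : m ≠ 0) :
    ∑ a ∈ m.divisors, (ArithmeticFunction.moebius a : ℚ) / (a : ℚ) ^ 2 =
      ∏ p ∈ m.primeFactors, (1 - 1 / (p : ℚ) ^ 2) := by
  let f : ArithmeticFunction ℚ := ⟨fun a => 1 / (a : ℚ) ^ 2, by simp⟩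
  have hf : f.IsMultiplicative :=
    ⟨by simp [f], fun {a b} _ => by simp [f, mul_pow, mul_comm]⟩
  simpa [f, div_eq_mul_inv] using sum_divisors_moebius_mul_eq_prod_primeFactors hf hm

/-- Euler's totient as `m · Π_{p | m} (1 + 1/p)⁻¹ · Σ_{a | m} μ(a)/a²`. -/
theorem totient_eq_mul_prod_mul_sum_moebius_div_sq {m : ℕ} (hm : m ≠ 0) :
    (m : ℚ) * (∏ p ∈ m.primeFactors, ((1 : ℚ) + 1 / (p : ℚ))⁻¹) *
      ∑ a ∈ m.divisors, (ArithmeticFunction.moebius a : ℚ) / (a : ℚ) ^ 2 = m.totient := by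
  rw [sum_divisors_moebius_div_sq hm, Nat.totient_eq_mul_prod_factors, mul_assoc,
    ← Finset.prod_mul_distrib]
  congr 1
  refine Finset.prod_congr rfl fun p hp => ?_
  have hp0 : (0 : ℚ) < p := mod_cast (Nat.prime_of_mem_primeFactors hp).pos
  field_simp
  ring

/-- Reindex the double sum over `a | d | n` by the involution `d ↦ n·a/d` on the multiples of `a`
dividing `n`. -/
theorem sum_divisors_sum_divisors_mul_div {M : Type*} [AddCommMonoid M] (n : ℕ)
    (F : ℕ → ℕ → M) :
    ∑ d ∈ n.divisors, ∑ a ∈ d.divisors, F d a =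
      ∑ m ∈ n.divisors, ∑ a ∈ m.divisors, F (n * a / m) a := by
  have key : ∀ d a : ℕ, d ∣ n ∧ n ≠ 0 → a ∣ d ∧ d ≠ 0 →
      (n * a / d ∣ n ∧ n ≠ 0) ∧ (a ∣ n * a / d ∧ n * a / d ≠ 0) ∧ n * a / (n * a / d) = d := by
    rintro d a ⟨⟨c, rfl⟩, hn⟩ ⟨⟨b, rfl⟩, hd⟩
    obtain ⟨ha, hb⟩ := mul_ne_zero_iff.1 hd
    have hc := (mul_ne_zero_iff.1 hn).2
    have h : a * b * c * a / (a * b) = a * c :=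
      Nat.div_eq_of_eq_mul_left (Nat.pos_of_ne_zero hd) (by ring)
    have h' : a * b * c * a / (a * c) = a * b :=
      Nat.div_eq_of_eq_mul_left (Nat.pos_of_ne_zero (mul_ne_zero ha hc)) (by ring)
    rw [h]
    exact ⟨⟨⟨b, by ring⟩, hn⟩, ⟨dvd_mul_right a c, mul_ne_zero ha hc⟩, h'⟩
  rw [Finset.sum_sigma', Finset.sum_sigma']
  refine Finset.sum_bij' (fun x _ => ⟨n * x.2 / x.1, x.2⟩) (fun x _ => ⟨n * x.2 / x.1, x.2⟩)
    ?_ ?_ ?_ ?_ ?_ <;>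
  · rintro ⟨d, a⟩ hx
    simp only [Finset.mem_sigma, Nat.mem_divisors] at hx
    obtain ⟨h₁, h₂, h₃⟩ := key d a hx.1 hx.2
    simp [h₁, h₂, h₃]

/-- For a positive integer `n`, `Σ_{d | n} R(n,d) = 1/n`. -/
theorem stmt_5 (n : ℕ) (hn : 0 < n) :
    ∑ d ∈ n.divisors, Rnd n d = 1 / (n : ℚ) := by
  have hn0 : (n : ℚ) ≠ 0 := mod_cast hn.ne'
  simp only [Rnd, Finset.mul_sum]
  rw [sum_divisors_sum_divisors_mul_div]
  have inner : ∀ m ∈ n.divisors, ∑ a ∈ m.divisors,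
      1 / (((n * a / m : ℕ) : ℚ) * (n : ℚ)) *
        ((ArithmeticFunction.moebius a : ℚ) / (a : ℚ) *
          ∏ p ∈ (n * a / (n * a / m)).primeFactors, ((1 : ℚ) + 1 / (p : ℚ))⁻¹) =
      1 / (n : ℚ) ^ 2 * (m.totient : ℚ) := by
    intro m hm
    have hmn := Nat.dvd_of_mem_divisors hm
    have hm0 : m ≠ 0 := (Nat.pos_of_mem_divisors hm).ne'
    rw [← totient_eq_mul_prod_mul_sum_moebius_div_sq hm0, Finset.mul_sum, Finset.mul_sum]
    refine Finset.sum_congr rfl fun a ha => ?_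
    have ha0 : a ≠ 0 := (Nat.pos_of_mem_divisors ha).ne'
    have hdvd : m ∣ n * a := hmn.mul_right a
    rw [Nat.div_div_self hdvd (mul_ne_zero hn.ne' ha0),
      Nat.cast_div hdvd (mod_cast hm0)]
    have ha' : (a : ℚ) ≠ 0 := mod_cast ha0
    have hm' : (m : ℚ) ≠ 0 := mod_cast hm0
    push_cast
    generalize ∏ p ∈ m.primeFactors, ((1 : ℚ) + 1 / (p : ℚ))⁻¹ = P
    field_simp
  rw [Finset.sum_congr rfl inner, ← Finset.mul_sum, ← Nat.cast_sum, Nat.sum_totient]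
  field_simp
end

section
/- Let a ∈ ℕ, n := D·a, and let l ∈ O_K satisfy gcd(l, √D) = 1 (equivalently D ∤ N(l)). Then: (i) for r ∈ O_K with r·r' ≡ 1 (mod n), the quantity e(Tr(r·l)/n) depends only on the class of r modulo n/√D, and the condition r·r' ≡ 1 (mod n) is itself invariant under r ↦ r + μ·(n/√D) for μ ∈ O_K; (ii) Σ_{r ∈ O_K/(n/√D), r·r' ≡ 1 (mod n)} e(Tr(r·l)/n) = (1/√D) · Σ_{r ∈ ℕ, r | l in O_K, r | a} r · S_D(N(l)/r², 1, D·a/r), where S_D(u, w, c) := Σ_{x mod c, gcd(x,c)=1} χ_D(x)·e((u·x̄ + w·x)/c), x̄ denoting the multiplicative inverse of x modulo c. -/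
open scoped Classical

/-- `e(x) = exp(2πix)` for real `x`. -/
noncomputable def e2pi (x : ℝ) : ℂ := Complex.exp (2 * (Real.pi : ℂ) * Complex.I * (x : ℂ))

/-- The twisted Kloosterman sum
`S_D(u, w, c) = Σ_{x mod c, gcd(x,c)=1} χ_D(x)·e((u·x̄ + w·x)/c)`, where `χ_D` is the
Legendre symbol modulo `D` and `x̄` is the multiplicative inverse of `x` modulo `c`. -/
noncomputable def SD (D : ℕ) [Fact (Nat.Prime D)] (u w : ℤ) (c : ℕ) : ℂ :=
  ∑ x ∈ (Finset.range c).filter (fun x => Nat.Coprime x c),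
    (legendreSym D (x : ℤ) : ℂ) *
      e2pi (((u * (((x : ZMod c)⁻¹).val : ℤ) + w * (x : ℤ) : ℤ) : ℝ) / (c : ℝ))

theorem hasSum_iff_of_eq {ι : Type*} {f g : ι → ℂ} {z : ℂ} (h : ∀ i, f i = g i) :
    HasSum f z ↔ HasSum g z := by
  rw [funext h]

open Filter Topology Complex in
theorem Complex.ofReal_mul_cpow_half {r : ℝ} (hr : 0 < r) {z : ℂ} (hz : z ≠ 0) :
    ((r : ℂ) * z) ^ (1 / 2 : ℂ) = (Real.sqrt r : ℂ) * z ^ (1 / 2 : ℂ) := by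
  have hr' : (r : ℂ) ≠ 0 := by exact_mod_cast hr.ne'
  have h1 : ((Real.sqrt r : ℝ) : ℂ) = (r : ℂ) ^ (1 / 2 : ℂ) := by
    rw [Real.sqrt_eq_rpow, Complex.ofReal_cpow hr.le]; simp
  rw [h1, Complex.cpow_def_of_ne_zero (mul_ne_zero hr' hz), Complex.cpow_def_of_ne_zero hr',
    Complex.cpow_def_of_ne_zero hz, Complex.log_ofReal_mul hr hz, ← Complex.exp_add,
    Complex.ofReal_log hr.le]
  ring_nf

open Filter Topology Complex in
theorem jacobiTheta_neg_half_odd_add {p : ℕ} (hp : p % 4 = 1) {w : ℂ} (hw : 0 < w.im) :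
    jacobiTheta (-(p : ℂ) / 2 + w) = (1 + I) * jacobiTheta (4 * w) - I * jacobiTheta w := by
  have hsum : ∀ {τ : ℂ}, 0 < τ.im →
      HasSum (fun n : ℤ => cexp (Real.pi * I * (n : ℂ) ^ 2 * τ)) (jacobiTheta τ) := by
    intro τ hτ
    have := hasSum_jacobiTheta₂_term 0 hτ
    simpa [jacobiTheta₂_term, jacobiTheta_eq_jacobiTheta₂] using this
  have h4 : 0 < (4 * w).im := by simpa using hw
  have him : 0 < (-(p : ℂ) / 2 + w).im := by
    have : (-(p : ℂ) / 2) = ((-(p : ℝ) / 2 : ℝ) : ℂ) := by push_cast; ring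
    rw [this, Complex.add_im, Complex.ofReal_im, zero_add]; exact hw
  have heven : HasSum (fun n : ℤ => if Even n then cexp (Real.pi * I * (n : ℂ) ^ 2 * w) else 0)
      (jacobiTheta (4 * w)) := by
    have hinj : Function.Injective (fun k : ℤ => 2 * k) := fun a b h => by simpa using h
    rw [← hinj.hasSum_iff]
    · convert hsum h4 using 2 with k
      simp only [Function.comp, even_two_mul, if_true]
      push_cast; ring_nf
    · intro n hn
      rw [if_neg]
      rintro ⟨k, rfl⟩
      exact hn ⟨k, by ring⟩
  have key := (heven.mul_left (1 + I)).sub ((hsum hw).mul_left I)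
  refine (hsum him).unique ?_
  refine (hasSum_iff_of_eq fun n => ?_).mpr key
  obtain ⟨j, hj⟩ : ∃ j : ℕ, p = 4 * j + 1 := ⟨p / 4, by omega⟩
  have hexp : ∀ z : ℂ, cexp (Real.pi * I * (n : ℂ) ^ 2 * (-(p : ℂ) / 2 + w))
      = cexp (Real.pi * I * (n : ℂ) ^ 2 * (-(p : ℂ) / 2)) * cexp (Real.pi * I * (n : ℂ) ^ 2 * w) :=
    fun _ => by rw [← Complex.exp_add]; ring_nf
  rw [hexp 0]
  rcases Int.even_or_odd' n with ⟨k, rfl | rfl⟩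
  · have : cexp (Real.pi * I * ((2 * k : ℤ) : ℂ) ^ 2 * (-(p : ℂ) / 2)) = 1 := by
      rw [Complex.exp_eq_one_iff]
      refine ⟨-(k ^ 2 * p), ?_⟩
      push_cast; ring
    rw [this, if_pos (even_two_mul k)]; ring
  · have : cexp (Real.pi * I * ((2 * k + 1 : ℤ) : ℂ) ^ 2 * (-(p : ℂ) / 2)) = -I := by
      have h2 : Real.pi * I * ((2 * k + 1 : ℤ) : ℂ) ^ 2 * (-(p : ℂ) / 2)
          = -(Real.pi / 2 * I) + ((-(2 * j * k ^ 2 + 2 * j * k) * 2 - j - (k ^ 2 + k) : ℤ) : ℂ)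
            * (2 * Real.pi * I) := by
        rw [hj]; push_cast; ring
      have h3 : Complex.exp (((-(2 * j * k ^ 2 + 2 * j * k) * 2 - j - (k ^ 2 + k) : ℤ) : ℂ)
            * (2 * Real.pi * I)) = 1 := Complex.exp_int_mul_two_pi_mul_I _
      rw [h2, Complex.exp_add, h3, Complex.exp_neg, Complex.exp_pi_div_two_mul_I]
      simp
    rw [this, if_neg (by simp [parity_simps])]; ring

open Filter Topology Complex in
theorem tendsto_jacobiTheta_of_im {α : Type*} {L : Filter α} {u : α → ℂ}
    (hu : Tendsto (fun x => (u x).im) L atTop) : Tendsto (fun x => jacobiTheta (u x)) L (𝓝 1) := by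
  have h1 := isBigO_at_im_infty_jacobiTheta_sub_one
  have h2 : Tendsto (fun τ : ℂ => Real.exp (-Real.pi * τ.im)) (comap im atTop) (𝓝 0) := by
    refine Real.tendsto_exp_atBot.comp ?_
    exact tendsto_comap.const_mul_atTop_of_neg (by linarith [Real.pi_pos])
  have h3 := h1.trans_tendsto h2
  have h4 : Tendsto u L (comap im atTop) := tendsto_comap_iff.mpr hu
  simpa using (h3.comp h4).add_const 1

open Filter Topology in
theorem tendsto_cosKernel (a : UnitAddCircle) :
    Tendsto (HurwitzZeta.cosKernel a) atTop (𝓝 1) := by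
  obtain ⟨q, hq, h⟩ := HurwitzZeta.isBigO_atTop_cosKernel_sub a
  have h2 : Tendsto (fun x : ℝ => Real.exp (-q * x)) atTop (𝓝 0) := by
    refine Real.tendsto_exp_atBot.comp ?_
    exact tendsto_id.const_mul_atTop_of_neg (by linarith)
  simpa using (h.trans_tendsto h2).add_const 1

open Complex in
theorem jacobiTheta_two_div_add (p : ℕ) [NeZero p] {ε : ℝ} (hε : 0 < ε) :
    jacobiTheta (2 / p + I * ε) = ∑ k : Fin p,
      cexp (2 * Real.pi * I * (k : ℕ) ^ 2 / p) *
        HurwitzZeta.evenKernel (((k : ℕ) / p : ℝ) : UnitAddCircle) (p ^ 2 * ε) := by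
  have hp0 : (p : ℂ) ≠ 0 := by exact_mod_cast NeZero.ne p
  have hp1 : (p : ℝ) ≠ 0 := by exact_mod_cast NeZero.ne p
  have hpp : (0 : ℝ) < p ^ 2 * ε := by positivity
  have him : 0 < (2 / p + I * ε : ℂ).im := by
    have : (2 / p : ℂ) = ((2 / p : ℝ) : ℂ) := by push_cast; ring
    rw [this, Complex.add_im, Complex.ofReal_im]; simpa using hε
  have hs : HasSum (fun n : ℤ => cexp (Real.pi * I * (n : ℂ) ^ 2 * (2 / p + I * ε)))
      (jacobiTheta (2 / p + I * ε)) := by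
    simpa [jacobiTheta₂_term, jacobiTheta_eq_jacobiTheta₂] using hasSum_jacobiTheta₂_term 0 him
  let e : Fin p × ℤ ≃ ℤ := (Equiv.prodComm _ _).trans (Int.divModEquiv p).symm
  have hs2 := e.hasSum_iff.mpr hs
  have hk : ∀ k : Fin p, HasSum (fun m : ℤ => cexp (Real.pi * I * ((e (k, m) : ℤ) : ℂ) ^ 2 *
      (2 / p + I * ε))) (cexp (2 * Real.pi * I * (k : ℕ) ^ 2 / p) *
        HurwitzZeta.evenKernel (((k : ℕ) / p : ℝ) : UnitAddCircle) (p ^ 2 * ε)) := by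
    intro k
    have h := HurwitzZeta.hasSum_int_evenKernel (((k : ℕ) / p : ℝ)) hpp
    rw [← Complex.hasSum_ofReal] at h
    refine (hasSum_iff_of_eq fun m => ?_).mpr (h.mul_left (cexp (2 * Real.pi * I * (k : ℕ) ^ 2 / p)))
    have he : e (k, m) = m * p + (k : ℕ) := by simp [e, Int.divModEquiv]
    rw [he, Complex.ofReal_exp, ← Complex.exp_add, Complex.exp_eq_exp_iff_exists_int]
    refine ⟨m ^ 2 * p + 2 * m * (k : ℕ), ?_⟩
    push_cast
    field_simp
    ring_nf
    simp only [I_sq]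
    ring
  exact (hs2.prod_fiberwise hk).unique (hasSum_fintype _)

open Filter Topology Complex in
theorem sum_exp_sq_div_eq_sqrt {p : ℕ} (hp : p % 4 = 1) :
    ∑ k : Fin p, cexp (2 * Real.pi * I * (k : ℕ) ^ 2 / p) = (Real.sqrt p : ℂ) := by
  have : NeZero p := ⟨by omega⟩
  have hp0 : (p : ℂ) ≠ 0 := by exact_mod_cast NeZero.ne p
  have hp1 : (0 : ℝ) < p := by exact_mod_cast Nat.pos_of_ne_zero (NeZero.ne p)
  have hsp : (Real.sqrt p : ℂ) * Real.sqrt p = p := by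
    rw [← Complex.ofReal_mul, Real.mul_self_sqrt hp1.le]; simp
  have hsp0 : (Real.sqrt p : ℂ) ≠ 0 := by
    intro h; rw [h] at hsp; simp at hsp; exact hp0 hsp.symm
  -- the two sides of the theta transformation, normalised by `√ε`
  have hL : Tendsto (fun ε : ℝ => (Real.sqrt ε : ℂ) * jacobiTheta (2 / p + I * ε)) (𝓝[>] 0)
      (𝓝 (∑ k : Fin p, cexp (2 * Real.pi * I * (k : ℕ) ^ 2 / p) * (1 / p * (1 : ℝ)))) := by
    have h1 : Tendsto (fun ε : ℝ => 1 / ((p : ℝ) ^ 2 * ε)) (𝓝[>] 0) atTop := by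
      have := (tendsto_inv_nhdsGT_zero (𝕜 := ℝ)).const_mul_atTop (r := 1 / (p : ℝ) ^ 2)
        (by positivity)
      refine this.congr fun ε => by ring
    have h2 : Tendsto (fun ε : ℝ => ∑ k : Fin p, cexp (2 * Real.pi * I * (k : ℕ) ^ 2 / p) *
        (1 / p * (HurwitzZeta.cosKernel (((k : ℕ) / p : ℝ) : UnitAddCircle)
          (1 / ((p : ℝ) ^ 2 * ε)) : ℂ))) (𝓝[>] 0)
        (𝓝 (∑ k : Fin p, cexp (2 * Real.pi * I * (k : ℕ) ^ 2 / p) * (1 / p * (1 : ℝ)))) := by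
      refine tendsto_finsetSum _ fun k _ => Tendsto.const_mul _ (Tendsto.const_mul _ ?_)
      exact (Complex.continuous_ofReal.tendsto 1).comp ((tendsto_cosKernel _).comp h1)
    refine h2.congr' ?_
    filter_upwards [self_mem_nhdsWithin] with ε hε
    have hε : 0 < ε := hε
    rw [jacobiTheta_two_div_add p hε, Finset.mul_sum]
    refine Finset.sum_congr rfl fun k _ => ?_
    rw [HurwitzZeta.evenKernel_functional_equation, ← Real.sqrt_eq_rpow,
      Real.sqrt_mul (by positivity), Real.sqrt_sq hp1.le]
    have : (Real.sqrt ε : ℂ) ≠ 0 := by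
      exact_mod_cast (Real.sqrt_pos.mpr hε).ne'
    push_cast
    field_simp
  have hR : Tendsto (fun ε : ℝ => (Real.sqrt ε : ℂ) * jacobiTheta (2 / p + I * ε)) (𝓝[>] 0)
      (𝓝 (1 / p * Real.sqrt p)) := by
    let u : ℝ → ℂ := fun ε => 4 * I / (p ^ 2 * ε) - 2 / p
    let v : ℝ → ℂ := fun ε => p ^ 2 / (4 + 2 * I * p * ε)
    have hu_im : ∀ ε : ℝ, (u ε).im = 4 / ((p : ℝ) ^ 2 * ε) := by
      intro ε
      have : u ε = ((-2 / p : ℝ) : ℂ) + ((4 / ((p : ℝ) ^ 2 * ε) : ℝ) : ℂ) * I := by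
        simp only [u]; push_cast; ring
      rw [this, Complex.add_im, Complex.ofReal_im, Complex.im_ofReal_mul, Complex.I_im]
      ring
    have hinv : Tendsto (fun ε : ℝ => (u ε).im) (𝓝[>] 0) atTop := by
      have := (tendsto_inv_nhdsGT_zero (𝕜 := ℝ)).const_mul_atTop (r := 4 / (p : ℝ) ^ 2)
        (by positivity)
      refine this.congr fun ε => by rw [hu_im]; ring
    have hu1 := tendsto_jacobiTheta_of_im hinv
    have hu4 : Tendsto (fun ε : ℝ => jacobiTheta (u ε / 4)) (𝓝[>] 0) (𝓝 1) := by
      refine tendsto_jacobiTheta_of_im ((hinv.const_mul_atTop (r := 1 / 4) (by norm_num)).congr ?_)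
      intro ε
      have : u ε / 4 = ((1 / 4 : ℝ) : ℂ) * u ε := by push_cast; ring
      rw [this, Complex.im_ofReal_mul]
    have hv : Tendsto (fun ε : ℝ => v ε ^ (1 / 2 : ℂ)) (𝓝[>] 0) (𝓝 (p / 2)) := by
      have h0 : v 0 = ((p / 2 : ℝ) : ℂ) * ((p / 2 : ℝ) : ℂ) := by
        simp only [v]; push_cast; ring
      have hval : v 0 ^ (1 / 2 : ℂ) = p / 2 := by
        rw [h0, ← sq, one_div, Complex.sq_cpow_two_inv (by rw [Complex.ofReal_re]; positivity)]
        push_cast; ring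
      rw [← hval]
      refine Tendsto.mono_left ?_ nhdsWithin_le_nhds
      have hc : ContinuousAt v 0 := by
        refine ContinuousAt.div (by fun_prop) (by fun_prop) (by simp)
      refine (hc.cpow continuousAt_const ?_).tendsto
      rw [h0, ← Complex.ofReal_mul]
      exact Complex.ofReal_mem_slitPlane.mpr (by positivity)
    have hτ : Tendsto (fun ε : ℝ => ((ε : ℂ) - 2 * I / p) ^ (1 / 2 : ℂ)) (𝓝[>] 0)
        (𝓝 ((1 - I) / Real.sqrt p)) := by
      have hval : (((0 : ℝ) : ℂ) - 2 * I / p) ^ (1 / 2 : ℂ) = (1 - I) / Real.sqrt p := by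
        have h1 : (((0 : ℝ) : ℂ) - 2 * I / p) = ((1 - I) / Real.sqrt p) ^ 2 := by
          rw [div_pow, sq (Real.sqrt p : ℂ), hsp]
          ring_nf; simp only [I_sq]; push_cast; ring
        rw [h1, one_div, Complex.sq_cpow_two_inv]
        rw [Complex.div_ofReal_re]
        simpa using hp1
      rw [← hval]
      refine Tendsto.mono_left ?_ nhdsWithin_le_nhds
      refine (ContinuousAt.cpow (f := fun ε : ℝ => ((ε : ℂ) - 2 * I / p)) (by fun_prop)
        continuousAt_const ?_).tendsto
      refine Complex.mem_slitPlane_iff.mpr (Or.inr ?_)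
      have : (((0 : ℝ) : ℂ) - 2 * I / p) = ((-2 / p : ℝ) : ℂ) * I := by push_cast; ring
      rw [this, Complex.im_ofReal_mul, Complex.I_im, mul_one]
      exact (div_neg_of_neg_of_pos (by norm_num) hp1).ne
    have hne1 : (1 - I : ℂ) / Real.sqrt p ≠ 0 := by
      refine div_ne_zero ?_ hsp0
      intro h
      have := congrArg Complex.re h
      simp at this
    have hne2 : (p / 2 : ℂ) ≠ 0 := div_ne_zero hp0 two_ne_zero
    have hlim := ((hτ.inv₀ hne1).mul (hv.inv₀ hne2)).mul
      ((hu4.const_mul ((1 + I) / 2)).sub (hu1.const_mul I))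
    have hconst : ((1 - I : ℂ) / Real.sqrt p)⁻¹ * (p / 2 : ℂ)⁻¹ * ((1 + I) / 2 * 1 - I * 1)
        = 1 / p * Real.sqrt p := by
      have : (1 - I : ℂ) ≠ 0 := fun h => hne1 (by rw [h, zero_div])
      field_simp
      ring
    rw [hconst] at hlim
    refine hlim.congr' ?_
    filter_upwards [self_mem_nhdsWithin] with ε hε
    have hε : 0 < ε := hε
    have hεc : (ε : ℂ) ≠ 0 := by exact_mod_cast hε.ne'
    have hfe : ∀ τ : ℂ, jacobiTheta τ = 1 / (-I * τ) ^ (1 / 2 : ℂ) * jacobiTheta (-1 / τ) := by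
      intro τ
      rw [jacobiTheta_eq_jacobiTheta₂, jacobiTheta₂_functional_equation]
      simp [jacobiTheta_eq_jacobiTheta₂]
    have hden : (4 + 2 * I * p * ε : ℂ) ≠ 0 := by
      intro h
      have := congrArg Complex.re h
      simp at this
    have hu0 : u ε ≠ 0 := by
      intro h
      have h1 := hu_im ε
      rw [h, Complex.zero_im] at h1
      have h2 : 0 < 4 / ((p : ℝ) ^ 2 * ε) := by positivity
      exact h2.ne h1
    have hv0 : v ε ≠ 0 := div_ne_zero (pow_ne_zero _ hp0) hden
    have huv : u ε * (ε * v ε) = I := by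
      have : u ε = (4 + 2 * I * p * ε) * I / (p ^ 2 * ε) := by
        simp only [u]
        rw [div_sub_div _ _ (by positivity) hp0, div_eq_div_iff (by positivity) (by positivity)]
        linear_combination (-2 * p ^ 4 * ε ^ 2 : ℂ) * I_sq
      rw [this]
      simp only [v]
      field_simp
    have hw_im : 0 < (-1 / u ε).im := by
      rw [neg_div, Complex.neg_im, one_div, Complex.inv_im, neg_div, neg_neg]
      refine div_pos ?_ (Complex.normSq_pos.mpr hu0)
      rw [hu_im]; positivity
    have h1 : -1 / (2 / p + I * ε : ℂ) = -(p : ℂ) / 2 + -1 / u ε := by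
      have h2 : -1 / u ε = I * ε * v ε := by
        rw [div_eq_iff hu0]
        linear_combination -I * huv - I_sq
      rw [h2]
      simp only [v]
      have h3 : (2 + I * p * ε : ℂ) ≠ 0 := fun h => hden (by linear_combination 2 * h)
      have h4 : (2 / p + I * ε : ℂ) = (2 + I * p * ε) / p := by field_simp
      rw [h4, show (4 + 2 * I * p * ε : ℂ) = 2 * (2 + I * p * ε) by ring]
      field_simp
      ring
    have hw1 : -I * (-1 / u ε) = ε * v ε := by
      field_simp
      rw [← huv]; ring
    symm
    rw [hfe (2 / p + I * ε), h1, jacobiTheta_neg_half_odd_add hp hw_im, hfe (4 * (-1 / u ε)),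
      hfe (-1 / u ε),
      show -I * (4 * (-1 / u ε)) = ((4 * ε : ℝ) : ℂ) * v ε by
        push_cast; linear_combination 4 * hw1,
      hw1, Complex.ofReal_mul_cpow_half hε hv0,
      Complex.ofReal_mul_cpow_half (by positivity) hv0,
      show -1 / (-1 / u ε) = u ε by field_simp,
      show -1 / (4 * (-1 / u ε)) = u ε / 4 by field_simp,
      show -I * (2 / p + I * ε) = (ε : ℂ) - 2 * I / p by
        ring_nf; simp only [I_sq]; ring,
      Real.sqrt_mul (by norm_num), show Real.sqrt 4 = 2 by
        rw [show (4 : ℝ) = 2 ^ 2 by norm_num]; exact Real.sqrt_sq (by norm_num)]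
    have hs : (Real.sqrt ε : ℂ) ≠ 0 := by
      exact_mod_cast (Real.sqrt_pos.mpr hε).ne'
    push_cast
    field_simp
  have := tendsto_nhds_unique hL hR
  rw [← Finset.sum_mul] at this
  field_simp at this
  simpa using this

/-- The additive character `x ↦ e(x / c)` on `ℤ`. -/
noncomputable def expMod (c : ℕ) (x : ℤ) : ℂ := e2pi ((x : ℝ) / (c : ℝ))

theorem expMod_eq_stdAddChar (c : ℕ) [NeZero c] (x : ℤ) :
    expMod c x = ZMod.stdAddChar (x : ZMod c) := by
  rw [ZMod.stdAddChar_coe, expMod, e2pi]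
  congr 1
  push_cast
  ring

theorem expMod_add (c : ℕ) (x y : ℤ) : expMod c (x + y) = expMod c x * expMod c y := by
  simp only [expMod, e2pi]
  rw [← Complex.exp_add]
  congr 1
  push_cast
  ring

theorem expMod_eq_one_iff {c : ℕ} (hc : c ≠ 0) (x : ℤ) : expMod c x = 1 ↔ (c : ℤ) ∣ x := by
  have : NeZero c := ⟨hc⟩
  rw [expMod_eq_stdAddChar, ← ZMod.intCast_zmod_eq_zero_iff_dvd,
    ← (ZMod.stdAddChar (N := c)).map_zero_eq_one]
  exact ZMod.injective_stdAddChar.eq_iff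

theorem expMod_congr {c : ℕ} {x y : ℤ} (h : (c : ℤ) ∣ x - y) : expMod c x = expMod c y := by
  rcases eq_or_ne c 0 with rfl | hc
  · simp [expMod]
  · rw [show x = (x - y) + y by ring, expMod_add, (expMod_eq_one_iff hc _).mpr h, one_mul]

theorem expMod_mul_left {k : ℕ} (hk : k ≠ 0) (c : ℕ) (x : ℤ) :
    expMod (k * c) (k * x) = expMod c x := by
  have : (k : ℝ) ≠ 0 := by exact_mod_cast hk
  simp only [expMod]
  congr 1
  push_cast
  rw [mul_div_mul_left _ _ this]

theorem expMod_mul_right {k : ℕ} (hk : k ≠ 0) (c : ℕ) (x : ℤ) :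
    expMod (c * k) (x * k) = expMod c x := by
  rw [mul_comm c, mul_comm x, expMod_mul_left hk]

theorem sum_range_natCast_zmod (n : ℕ) [NeZero n] (f : ZMod n → ℂ) :
    ∑ t ∈ Finset.range n, f (t : ZMod n) = ∑ z : ZMod n, f z := by
  refine Finset.sum_bij (fun t _ => (t : ZMod n)) (fun _ _ => Finset.mem_univ _) ?_ ?_
    (fun _ _ => rfl)
  · intro s hs t ht h
    rw [ZMod.natCast_eq_natCast_iff'] at h
    rwa [Nat.mod_eq_of_lt (Finset.mem_range.mp hs), Nat.mod_eq_of_lt (Finset.mem_range.mp ht)] at h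
  · intro z _
    exact ⟨z.val, Finset.mem_range.mpr (ZMod.val_lt z), ZMod.natCast_zmod_val z⟩

theorem sum_range_expMod_mul {n : ℕ} (hn : n ≠ 0) (x : ℤ) :
    ∑ t ∈ Finset.range n, expMod n (t * x) = if (n : ℤ) ∣ x then (n : ℂ) else 0 := by
  have : NeZero n := ⟨hn⟩
  have h1 : ∀ t : ℕ, expMod n (t * x) = ZMod.stdAddChar ((t : ZMod n) * (x : ZMod n)) := by
    intro t
    rw [expMod_eq_stdAddChar]; push_cast; rfl
  simp_rw [h1]
  rw [sum_range_natCast_zmod n (fun z => ZMod.stdAddChar (z * (x : ZMod n))),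
    AddChar.sum_mulShift _ (ZMod.isPrimitive_stdAddChar n), ZMod.card]
  simp only [ZMod.intCast_zmod_eq_zero_iff_dvd]
  split_ifs <;> simp

/-- The one-variable quadratic Gauss sum with numerator `t`. -/
noncomputable def quadGauss (p : ℕ) [NeZero p] (t : ZMod p) : ℂ :=
  ∑ z : ZMod p, ZMod.stdAddChar (t * z ^ 2)

section prime

variable {p : ℕ} [hp : Fact p.Prime]

theorem quadGauss_zero : quadGauss p 0 = p := by
  simp [quadGauss, ZMod.card]

theorem quadGauss_eq_mul_gaussSum (hp2 : p ≠ 2) {t : ZMod p} (ht : t ≠ 0) :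
    quadGauss p t = (quadraticChar (ZMod p) t : ℂ) *
      gaussSum ((quadraticChar (ZMod p)).ringHomComp (Int.castRingHom ℂ)) ZMod.stdAddChar := by
  have hchar : ringChar (ZMod p) ≠ 2 := (ZMod.ringChar_zmod_n p).substr hp2
  have hcard : ∀ c : ZMod p, (((Finset.univ.filter fun z : ZMod p => z ^ 2 = c).card : ℤ)) =
      quadraticChar (ZMod p) c + 1 := by
    intro c
    rw [← quadraticChar_card_sqrts hchar c]
    congr 2
    ext z
    simp
  have h1 : quadGauss p t = ∑ c : ZMod p, ((quadraticChar (ZMod p) c : ℂ) + 1) *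
      ZMod.stdAddChar (t * c) := by
    rw [quadGauss, ← Finset.sum_fiberwise (s := Finset.univ) (g := fun z : ZMod p => z ^ 2)]
    refine Finset.sum_congr rfl fun c _ => ?_
    rw [Finset.sum_congr rfl (g := fun _ => ZMod.stdAddChar (t * c))
      (fun z hz => by rw [(Finset.mem_filter.mp hz).2]), Finset.sum_const, nsmul_eq_mul]
    congr 1
    have := congrArg (Int.cast : ℤ → ℂ) (hcard c)
    push_cast at this
    exact this
  have h2 : ∑ c : ZMod p, ZMod.stdAddChar (t * c) = (0 : ℂ) := by
    have := AddChar.sum_mulShift t (ZMod.isPrimitive_stdAddChar p)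
    rw [if_neg ht] at this
    simpa [mul_comm] using this
  have h3 := gaussSum_mulShift_eq ((quadraticChar (ZMod p)).ringHomComp (Int.castRingHom ℂ))
    (ZMod.stdAddChar (N := p)) (Units.mk0 t ht)
  have hq : ((quadraticChar (ZMod p)).ringHomComp (Int.castRingHom ℂ)).IsQuadratic :=
    (quadraticChar_isQuadratic (ZMod p)).comp _
  rw [hq.inv] at h3
  rw [h1]
  simp_rw [add_mul, one_mul]
  rw [Finset.sum_add_distrib, h2, add_zero]
  simpa [gaussSum, AddChar.mulShift_apply] using h3

theorem quadGauss_eq_mul (hp2 : p ≠ 2) {t : ZMod p} (ht : t ≠ 0) :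
    quadGauss p t = (quadraticChar (ZMod p) t : ℂ) * quadGauss p 1 := by
  rw [quadGauss_eq_mul_gaussSum hp2 ht, quadGauss_eq_mul_gaussSum hp2 one_ne_zero]
  simp

theorem quadGauss_one_sq (hp2 : p ≠ 2) :
    quadGauss p 1 * quadGauss p 1 = (quadraticChar (ZMod p) (-1) : ℂ) * p := by
  have hchar : ringChar (ZMod p) ≠ 2 := (ZMod.ringChar_zmod_n p).substr hp2
  have hq : ((quadraticChar (ZMod p)).ringHomComp (Int.castRingHom ℂ)).IsQuadratic :=
    (quadraticChar_isQuadratic (ZMod p)).comp _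
  have hne : (quadraticChar (ZMod p)).ringHomComp (Int.castRingHom ℂ) ≠ 1 :=
    (MulChar.ringHomComp_ne_one_iff (RingHom.injective_int _)).mpr (quadraticChar_ne_one hchar)
  have := gaussSum_sq hne hq (ZMod.isPrimitive_stdAddChar p)
  rw [quadGauss_eq_mul_gaussSum hp2 one_ne_zero]
  simpa [sq, ZMod.card] using this

theorem quadGauss_one_eq_sqrt (hp4 : p % 4 = 1) : quadGauss p 1 = (Real.sqrt p : ℂ) := by
  rw [← sum_exp_sq_div_eq_sqrt hp4, quadGauss,
    ← sum_range_natCast_zmod p (fun z => ZMod.stdAddChar (1 * z ^ 2)), Finset.sum_range]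
  refine Finset.sum_congr rfl fun k _ => ?_
  have := ZMod.stdAddChar_coe (N := p) ((k : ℕ) ^ 2 : ℤ)
  push_cast at this
  rw [one_mul, this]

theorem sum_stdAddChar_form (hp2 : p ≠ 2) {D : ℕ} {m : ℤ} (hm : (D : ℤ) = 4 * m + 1) (s : ZMod p) :
    ∑ u : ZMod p, ∑ v : ZMod p, ZMod.stdAddChar (s * (u ^ 2 + u * v - (m : ZMod p) * v ^ 2)) =
      quadGauss p s * quadGauss p (-(s * (D : ZMod p) * (2⁻¹ : ZMod p) ^ 2)) := by
  have h2 : (2 : ZMod p) ≠ 0 := by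
    have : ringChar (ZMod p) ≠ 2 := (ZMod.ringChar_zmod_n p).substr hp2
    exact Ring.two_ne_zero this
  have hD : (D : ZMod p) = 4 * m + 1 := by exact_mod_cast congrArg (Int.cast : ℤ → ZMod p) hm
  have key : ∀ v : ZMod p, ∑ u : ZMod p, ZMod.stdAddChar (s * (u ^ 2 + u * v - (m : ZMod p) * v ^ 2)) =
      quadGauss p s * ZMod.stdAddChar (-(s * (D : ZMod p) * (2⁻¹ : ZMod p) ^ 2) * v ^ 2) := by
    intro v
    rw [← (Equiv.subRight (2⁻¹ * v)).sum_comp, quadGauss, Finset.sum_mul]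
    refine Finset.sum_congr rfl fun u _ => ?_
    rw [← AddChar.map_add_eq_mul]
    congr 1
    rw [hD, Equiv.subRight_apply]
    field_simp
    ring
  rw [Finset.sum_comm]
  simp_rw [key]
  rw [← Finset.mul_sum, quadGauss, quadGauss]

end prime

theorem sum_stdAddChar_form_self {D : ℕ} [hD : Fact D.Prime] (hD4 : D % 4 = 1) {m : ℤ}
    (hm : (D : ℤ) = 4 * m + 1) {s : ℤ} (hs : (s : ZMod D) ≠ 0) :
    ∑ u : ZMod D, ∑ v : ZMod D, ZMod.stdAddChar ((s : ZMod D) * (u ^ 2 + u * v - (m : ZMod D) * v ^ 2)) =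
      D * ((legendreSym D s : ℂ) * Real.sqrt D) := by
  have hD2 : D ≠ 2 := by rintro rfl; norm_num at hD4
  rw [sum_stdAddChar_form hD2 hm]
  simp only [CharP.cast_eq_zero, mul_zero, zero_mul, neg_zero, quadGauss_zero]
  rw [quadGauss_eq_mul hD2 hs, quadGauss_one_eq_sqrt hD4, legendreSym, mul_comm]

theorem sum_stdAddChar_form_of_ne {D p : ℕ} [hD : Fact D.Prime] [hp : Fact p.Prime]
    (hD4 : D % 4 = 1) (hpD : p ≠ D) {m : ℤ}
    (hm : (D : ℤ) = 4 * m + 1) {s : ZMod p} (hs : s ≠ 0) :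
    ∑ u : ZMod p, ∑ v : ZMod p, ZMod.stdAddChar (s * (u ^ 2 + u * v - (m : ZMod p) * v ^ 2)) =
      (p : ℂ) * (legendreSym D p : ℂ) := by
  rcases eq_or_ne p 2 with rfl | hp2
  · obtain rfl : s = 1 := Fin.eq_one_of_ne_zero s hs
    have hval : ZMod.stdAddChar (1 : ZMod 2) = (-1 : ℂ) := by
      have := ZMod.stdAddChar_coe (N := 2) 1
      rw [Int.cast_one] at this
      rw [this, ← Complex.exp_pi_mul_I]
      congr 1; push_cast; ring
    have hD2 : D ≠ 2 := by rintro rfl; norm_num at hD4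
    have hleg : legendreSym D ((2 : ℕ) : ℤ) = if Even m then 1 else -1 := by
      have h := legendreSym.at_two hD2
      rw [Nat.cast_ofNat, h, ZMod.χ₈_nat_eq_if_mod_eight]
      rcases Int.even_or_odd' m with ⟨k, rfl | rfl⟩
      · rw [if_neg (by omega), if_pos (by omega), if_pos (even_two_mul k)]
      · rw [if_neg (by omega), if_neg (by omega), if_neg (by simp [parity_simps])]
    have hsum : ∀ f : ZMod 2 → ℂ, ∑ u : ZMod 2, f u = f 0 + f 1 := fun f => Fin.sum_univ_two f
    rw [hleg]
    simp only [hsum]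
    rcases Int.even_or_odd' m with ⟨k, rfl | rfl⟩
    · have : ((2 * k : ℤ) : ZMod 2) = 0 := by
        rw [ZMod.intCast_zmod_eq_zero_iff_dvd]; exact ⟨k, by simp⟩
      rw [this, if_pos (even_two_mul k)]
      simp [hval, show (1 + 1 : ZMod 2) = 0 from rfl]
      norm_num
    · have : ((2 * k + 1 : ℤ) : ZMod 2) = 1 := by
        push_cast
        rw [show (2 : ZMod 2) = 0 from rfl]; ring
      rw [this, if_neg (by simp [parity_simps])]
      simp [hval, show (1 + 1 : ZMod 2) = 0 from rfl, show (-1 : ZMod 2) = 1 from rfl]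
      norm_num
  · have hDp : (D : ZMod p) ≠ 0 := by
      rw [Ne, ZMod.natCast_eq_zero_iff]
      exact fun h => hpD ((Nat.prime_dvd_prime_iff_eq hp.out hD.out).mp h)
    have h2 : (2 : ZMod p) ≠ 0 :=
      Ring.two_ne_zero ((ZMod.ringChar_zmod_n p).substr hp2)
    have hne : -(s * (D : ZMod p) * (2⁻¹ : ZMod p) ^ 2) ≠ 0 := by simp [hs, hDp, h2]
    have hrec := legendreSym.quadratic_reciprocity_one_mod_four (p := D) (q := p) hD4 hp2
    rw [sum_stdAddChar_form hp2 hm, quadGauss_eq_mul hp2 hs, quadGauss_eq_mul hp2 hne,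
      mul_mul_mul_comm, quadGauss_one_sq hp2, ← hrec, legendreSym]
    have hs2 := quadraticChar_sq_one hs
    have h12 := quadraticChar_sq_one (a := (2⁻¹ : ZMod p)) (inv_ne_zero h2)
    have h13 := quadraticChar_sq_one (a := (-1 : ZMod p)) (by simp)
    have : quadraticChar (ZMod p) s * quadraticChar (ZMod p) (-(s * (D : ZMod p) * (2⁻¹ : ZMod p) ^ 2)) *
        quadraticChar (ZMod p) (-1) = quadraticChar (ZMod p) D := by
      rw [show -(s * (D : ZMod p) * (2⁻¹ : ZMod p) ^ 2) = (-1) * (s * (D : ZMod p) * (2⁻¹) ^ 2) by ring]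
      simp only [map_mul, map_pow]
      rw [h12]
      linear_combination (quadraticChar (ZMod p) D * quadraticChar (ZMod p) (-1) ^ 2) * hs2 +
        quadraticChar (ZMod p) D * h13
    have hC := congrArg (Int.cast : ℤ → ℂ) this
    push_cast at hC ⊢
    rw [← hC]
    ring

theorem sum_range_add_of_periodic {N : ℕ} {g : ℤ → ℂ} (hg : ∀ x, g (x + N) = g x) (c : ℤ) :
    ∑ x ∈ Finset.range N, g (x + c) = ∑ x ∈ Finset.range N, g x := by
  have step : ∀ c : ℤ, ∑ x ∈ Finset.range N, g (x + (c + 1)) =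
      ∑ x ∈ Finset.range N, g (x + c) := by
    intro c
    have h1 := Finset.sum_range_succ (fun x : ℕ => g (x + c)) N
    have h2 := Finset.sum_range_succ' (fun x : ℕ => g (x + c)) N
    rw [h1, add_comm (N : ℤ) c, hg] at h2
    push_cast at h2
    rw [zero_add] at h2
    rw [add_right_cancel h2]
    exact Finset.sum_congr rfl fun x _ => by congr 1; ring
  induction c using Int.induction_on with
  | zero => simp
  | succ i ih => rw [step, ih]
  | pred i ih => rw [← ih, ← step, sub_add_cancel]

theorem sum_range_mul_of_periodic {k : ℕ} {g : ℤ → ℂ} (hg : ∀ x, g (x + k) = g x) (j : ℕ) :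
    ∑ x ∈ Finset.range (k * j), g x = j * ∑ x ∈ Finset.range k, g x := by
  induction j with
  | zero => simp
  | succ j ih =>
    rw [Nat.mul_succ, Finset.sum_range_add, ih]
    have : ∀ x : ℕ, g ((k * j + x : ℕ) : ℤ) = g (x + (k * j : ℤ)) := by
      intro x; congr 1; push_cast; ring
    simp_rw [this]
    rw [sum_range_add_of_periodic hg]
    push_cast
    ring

theorem sum_range_ite_dvd {k : ℕ} (hk : k ≠ 0) :
    ∑ x ∈ Finset.range k, (if (k : ℤ) ∣ (x : ℤ) then (1 : ℂ) else 0) = 1 := by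
  rw [Finset.sum_eq_single_of_mem 0 (Finset.mem_range.mpr (Nat.pos_of_ne_zero hk))]
  · simp
  · intro x hx hx0
    rw [if_neg]
    intro h
    exact hx0 (Nat.eq_zero_of_dvd_of_lt (Int.natCast_dvd_natCast.mp h) (Finset.mem_range.mp hx))

/-- The ring `ℤ[ω]` with `ω² = m + ω`, the quadratic order of discriminant `4 * m + 1`. -/
abbrev QuadOrder (m : ℤ) : Type := QuadraticAlgebra ℤ m 1

namespace QuadOrder

open QuadraticAlgebra

variable {m : ℤ}

/-- The square root `2 * ω - 1` of the discriminant. -/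
def disc (m : ℤ) : QuadOrder m := ⟨-1, 2⟩

theorem natCast_dvd_iff {k : ℕ} {z : QuadOrder m} :
    (k : QuadOrder m) ∣ z ↔ (k : ℤ) ∣ z.re ∧ (k : ℤ) ∣ z.im := by
  rw [← algebraMap_dvd_iff]
  simp

theorem disc_mul_disc : disc m * disc m = ((4 * m + 1 : ℤ) : QuadOrder m) := by
  ext
  · simp [disc]; ring
  · simp [disc]

theorem im_disc_mul (z : QuadOrder m) : (disc m * z).im = trace z := by
  simp [disc, trace_def]; ring

theorem trace_disc_mul (z : QuadOrder m) : trace (disc m * z) = (4 * m + 1) * z.im := by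
  simp [disc, trace_def]; ring

theorem norm_add (r s : QuadOrder m) :
    norm (r + s) = norm r + trace (s * star r) + norm s := by
  simp [norm_def, trace_def]; ring

theorem norm_disc : norm (disc m) = -(4 * m + 1) := by
  simp [norm_def, disc]; ring

theorem trace_natCast_mul (k : ℕ) (z : QuadOrder m) : trace ((k : QuadOrder m) * z) = k * trace z := by
  simp [trace_def]; ring

theorem trace_intCast_mul (k : ℤ) (z : QuadOrder m) : trace ((k : QuadOrder m) * z) = k * trace z := by
  simp [trace_def]; ring

theorem natCast_dvd_disc_mul_iff {c : ℕ} {z : QuadOrder m} :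
    (c : QuadOrder m) ∣ disc m * z ↔ ∀ μ : QuadOrder m, (c : ℤ) ∣ trace (μ * z) := by
  constructor
  · intro h μ
    rw [← im_disc_mul, mul_left_comm]
    exact (natCast_dvd_iff.mp (h.mul_left μ)).2
  · intro h
    have h1 := h 1
    have h2 := h ⟨0, 1⟩
    rw [one_mul] at h1
    rw [natCast_dvd_iff, im_disc_mul]
    refine ⟨?_, h1⟩
    have : (disc m * z).re = trace ((⟨0, 1⟩ : QuadOrder m) * z) - trace z := by
      simp [disc, trace_def]; ring
    exact this ▸ dvd_sub h2 h1

theorem natCast_mul_left_cancel {k : ℕ} (hk : k ≠ 0) {x y : QuadOrder m}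
    (h : (k : QuadOrder m) * x = k * y) : x = y := by
  have hk' : (k : ℤ) ≠ 0 := by exact_mod_cast hk
  have h1 := congrArg QuadraticAlgebra.re h
  have h2 := congrArg QuadraticAlgebra.im h
  simp at h1 h2
  ext
  · exact h1.resolve_right hk
  · exact h2.resolve_right hk

theorem natCast_mul_dvd_natCast_mul_iff {k : ℕ} (hk : k ≠ 0) {x y : QuadOrder m} :
    (k : QuadOrder m) * x ∣ k * y ↔ x ∣ y :=
  ⟨fun ⟨z, hz⟩ => ⟨z, natCast_mul_left_cancel hk (by rw [hz, mul_assoc])⟩, mul_dvd_mul_left _⟩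

/-- `f` is invariant under translation by multiples of `c`. -/
def PeriodicMod (c : QuadOrder m) (f : QuadOrder m → ℂ) : Prop :=
  ∀ r μ : QuadOrder m, f (r + c * μ) = f r

theorem PeriodicMod.of_dvd {c d : QuadOrder m} {f : QuadOrder m → ℂ} (hf : PeriodicMod c f)
    (h : c ∣ d) : PeriodicMod d f := by
  obtain ⟨e, rfl⟩ := h
  intro r μ
  rw [mul_assoc, hf]

/-- The average of a function over the residue classes modulo the integer `N`. -/
noncomputable def avg (N : ℕ) (f : QuadOrder m → ℂ) : ℂ :=
  ((N : ℂ) ^ 2)⁻¹ * ∑ x ∈ Finset.range N, ∑ y ∈ Finset.range N, f ⟨x, y⟩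

theorem PeriodicMod.re {N : ℕ} {f : QuadOrder m → ℂ} (hf : PeriodicMod (N : QuadOrder m) f)
    (x y : ℤ) : f ⟨x + N, y⟩ = f ⟨x, y⟩ := by
  rw [← hf ⟨x, y⟩ 1]
  congr 1
  ext <;> simp

theorem PeriodicMod.im {N : ℕ} {f : QuadOrder m → ℂ} (hf : PeriodicMod (N : QuadOrder m) f)
    (x y : ℤ) : f ⟨x, y + N⟩ = f ⟨x, y⟩ := by
  rw [← hf ⟨x, y⟩ ⟨0, 1⟩]
  congr 1
  ext <;> simp

theorem avg_add_right {N : ℕ} {f : QuadOrder m → ℂ} (hf : PeriodicMod (N : QuadOrder m) f)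
    (c : QuadOrder m) : avg N (fun r => f (r + c)) = avg N f := by
  rw [avg, avg]
  congr 1
  have h1 : ∀ x : ℤ, ∑ y ∈ Finset.range N, f (⟨x, y⟩ + c) =
      ∑ y ∈ Finset.range N, f ⟨x + c.re, y⟩ := by
    intro x
    rw [← sum_range_add_of_periodic (g := fun y => f ⟨x + c.re, y⟩) (hf.im _) c.im]
    exact Finset.sum_congr rfl fun y _ => by congr 1
  simp_rw [h1]
  rw [sum_range_add_of_periodic
    (g := fun x => ∑ y ∈ Finset.range N, f ⟨x, y⟩)
    (fun x => Finset.sum_congr rfl fun y _ => hf.re x y) c.re]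

theorem avg_const {N : ℕ} (hN : N ≠ 0) (z : ℂ) : avg (m := m) N (fun _ => z) = z := by
  have : (N : ℂ) ≠ 0 := by exact_mod_cast hN
  simp only [avg, Finset.sum_const, Finset.card_range, nsmul_eq_mul]
  field_simp

theorem avg_mul_left (N : ℕ) (z : ℂ) (f : QuadOrder m → ℂ) :
    avg N (fun r => z * f r) = z * avg N f := by
  simp only [avg, ← Finset.mul_sum]
  ring

theorem avg_sum (N : ℕ) {ι : Type*} (s : Finset ι) (F : ι → QuadOrder m → ℂ) :
    avg N (fun r => ∑ i ∈ s, F i r) = ∑ i ∈ s, avg N (F i) := by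
  simp only [avg]
  rw [← Finset.mul_sum, Finset.sum_comm]
  congr 1
  simp_rw [Finset.sum_comm (s := s)]
  rw [Finset.sum_comm]

theorem avg_comm (N : ℕ) (F : QuadOrder m → QuadOrder m → ℂ) :
    avg N (fun r => avg N (fun s => F r s)) = avg N (fun s => avg N (fun r => F r s)) := by
  simp only [avg, ← Finset.mul_sum]
  congr 2
  rw [Finset.sum_congr rfl fun x _ => Finset.sum_comm, Finset.sum_comm]
  refine Finset.sum_congr rfl fun x _ => ?_
  rw [Finset.sum_congr rfl fun x _ => Finset.sum_comm, Finset.sum_comm]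

theorem avg_eq_avg_of_dvd {k N : ℕ} (hN : N ≠ 0) (h : k ∣ N) {f : QuadOrder m → ℂ}
    (hf : PeriodicMod (k : QuadOrder m) f) : avg N f = avg k f := by
  obtain ⟨j, rfl⟩ := h
  have hk : (k : ℂ) ≠ 0 := by exact_mod_cast left_ne_zero_of_mul hN
  have hj : (j : ℂ) ≠ 0 := by exact_mod_cast right_ne_zero_of_mul hN
  rw [avg, avg]
  have h1 : ∀ x : ℤ, ∑ y ∈ Finset.range (k * j), f ⟨x, y⟩ =
      j * ∑ y ∈ Finset.range k, f ⟨x, y⟩ :=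
    fun x => sum_range_mul_of_periodic (g := fun y => f ⟨x, y⟩) (hf.im x) j
  simp_rw [h1]
  rw [← Finset.mul_sum, sum_range_mul_of_periodic
    (g := fun x => ∑ y ∈ Finset.range k, f ⟨x, y⟩)
    (fun x => Finset.sum_congr rfl fun y _ => hf.re x y) j]
  push_cast
  field_simp

theorem avg_expMod_trace {c N : ℕ} (hc : c ≠ 0) (hN : N ≠ 0) (h : c ∣ N) (β : QuadOrder m) :
    avg N (fun μ => expMod c (trace (μ * β))) =
      if (c : QuadOrder m) ∣ disc m * β then 1 else 0 := by
  split_ifs with hβ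
  · rw [natCast_dvd_disc_mul_iff] at hβ
    simp_rw [(expMod_eq_one_iff hc _).mpr (hβ _)]
    exact avg_const hN 1
  · rw [natCast_dvd_disc_mul_iff] at hβ
    push Not at hβ
    obtain ⟨ν, hν⟩ := hβ
    have hper : PeriodicMod (N : QuadOrder m) (fun μ => expMod c (trace (μ * β))) := by
      intro r μ
      refine expMod_congr ?_
      rw [add_mul, map_add, mul_assoc, trace_natCast_mul, add_sub_cancel_left]
      exact (Int.natCast_dvd_natCast.mpr h).mul_right _
    have h1 := avg_add_right hper ν
    simp only [add_mul, map_add, expMod_add, mul_comm _ (expMod c (trace (ν * β)))] at h1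
    rw [avg_mul_left] at h1
    have h2 : expMod c (trace (ν * β)) ≠ 1 := fun h => hν ((expMod_eq_one_iff hc _).mp h)
    by_contra h0
    exact h2 (mul_right_cancel₀ h0 (by rw [h1, one_mul]))

theorem avg_eq_avg_ite_dvd {c N : ℕ} (hc : c ≠ 0) (hN : N ≠ 0) (h : c ∣ N)
    {f : QuadOrder m → ℂ} (hf : PeriodicMod (N : QuadOrder m) f) (x : QuadOrder m)
    (β : QuadOrder m → QuadOrder m)
    (hshift : ∀ r μ, f (r + x * μ) = f r * expMod c (trace (μ * β r))) :
    avg N f = avg N (fun r => if (c : QuadOrder m) ∣ disc m * β r then f r else 0) := by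
  calc avg N f = avg N (fun μ => avg N (fun r => f (r + x * μ))) := by
        simp_rw [avg_add_right hf]
        rw [avg_const hN]
    _ = avg N (fun r => avg N (fun μ => f r * expMod c (trace (μ * β r)))) := by
        rw [avg_comm]; simp_rw [hshift]
    _ = _ := by
        simp_rw [avg_mul_left, avg_expMod_trace hc hN h, mul_ite, mul_one, mul_zero]

/-- The density of the multiples of `c`, for `c` dividing `N`. -/
noncomputable def density (N : ℕ) (c : QuadOrder m) : ℂ :=
  avg N (fun r => if c ∣ r then 1 else 0)

theorem avg_ite_dvd {N : ℕ} (hN : N ≠ 0) {c : QuadOrder m} (hc : c ∣ (N : QuadOrder m))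
    {f : QuadOrder m → ℂ} (hf : PeriodicMod (N : QuadOrder m) f) :
    avg N (fun r => if c ∣ r then f r else 0) = density N c * avg N (fun s => f (c * s)) := by
  have hper : PeriodicMod (N : QuadOrder m) (fun r => if c ∣ r then f r else 0) := by
    intro r μ
    simp only [hf r μ, dvd_add_left (hc.mul_right μ)]
  have hper' : PeriodicMod (N : QuadOrder m) (fun s => f (c * s)) := by
    intro r μ
    simp only
    rw [mul_add, mul_left_comm, hf]
  calc _ = avg N (fun s => avg N (fun r => if c ∣ r then f (r + c * s) else 0)) := by
        rw [← avg_const (m := m) hN (avg N _)]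
        congr 1
        funext s
        rw [← avg_add_right hper (c * s)]
        simp only [dvd_add_left (dvd_mul_right c s)]
    _ = avg N (fun r => avg N (fun s => f (c * s)) * (if c ∣ r then 1 else 0)) := by
        rw [avg_comm]
        congr 1
        funext r
        split_ifs with h
        · obtain ⟨t, rfl⟩ := h
          rw [mul_one, ← avg_add_right hper' t]
          simp only [mul_add, add_comm]
        · rw [mul_zero, avg_const hN]
    _ = _ := by rw [avg_mul_left, density, mul_comm]

theorem density_natCast {N k : ℕ} (hN : N ≠ 0) (h : k ∣ N) :
    density N (k : QuadOrder m) = ((k : ℂ) ^ 2)⁻¹ := by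
  have hk : k ≠ 0 := ne_zero_of_dvd_ne_zero hN h
  have hper : PeriodicMod (k : QuadOrder m)
      (fun r => if (k : QuadOrder m) ∣ r then (1 : ℂ) else 0) := by
    intro r μ
    simp only [dvd_add_left (dvd_mul_right (k : QuadOrder m) μ)]
  rw [density, avg_eq_avg_of_dvd hN h hper, avg]
  simp only [natCast_dvd_iff, ite_and]
  have : ∀ x : ℕ, ∑ y ∈ Finset.range k, (if (k : ℤ) ∣ (x : ℤ) then
      (if (k : ℤ) ∣ (y : ℤ) then (1 : ℂ) else 0) else 0) =
      if (k : ℤ) ∣ (x : ℤ) then (1 : ℂ) else 0 := by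
    intro x
    split_ifs
    · exact sum_range_ite_dvd hk
    · simp
  simp_rw [this]
  rw [sum_range_ite_dvd hk, mul_one]

variable {D : ℕ}

theorem disc_mul_disc_eq (hm : (D : ℤ) = 4 * m + 1) : disc m * disc m = (D : QuadOrder m) := by
  rw [disc_mul_disc, ← hm, Int.cast_natCast]

theorem disc_mul_dvd_disc_mul_iff (hD : D ≠ 0) (hm : (D : ℤ) = 4 * m + 1) {x y : QuadOrder m} :
    disc m * x ∣ disc m * y ↔ x ∣ y := by
  refine ⟨fun h => ?_, mul_dvd_mul_left _⟩
  have := mul_dvd_mul_left (disc m) h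
  rwa [← mul_assoc, ← mul_assoc, disc_mul_disc_eq hm, natCast_mul_dvd_natCast_mul_iff hD] at this

theorem natCast_dvd_disc_mul_iff_disc_dvd (hD : D ≠ 0) (hm : (D : ℤ) = 4 * m + 1)
    {z : QuadOrder m} : (D : QuadOrder m) ∣ disc m * z ↔ disc m ∣ z := by
  rw [← disc_mul_disc_eq hm, disc_mul_dvd_disc_mul_iff hD hm]

theorem disc_dvd_iff (hD : D ≠ 0) (hm : (D : ℤ) = 4 * m + 1) {z : QuadOrder m} :
    disc m ∣ z ↔ (D : ℤ) ∣ trace z := by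
  rw [← natCast_dvd_disc_mul_iff_disc_dvd hD hm, natCast_dvd_iff, im_disc_mul]
  refine ⟨fun h => h.2, fun h => ⟨?_, h⟩⟩
  have : (disc m * z).re = 2 * m * trace z - D * z.re := by
    rw [hm]; simp [disc, trace_def]; ring
  rw [this]
  exact dvd_sub (h.mul_left _) (dvd_mul_right _ _)

theorem density_disc {N : ℕ} (hN : N ≠ 0) (hm : (D : ℤ) = 4 * m + 1) (h : D ∣ N) :
    density N (disc m) = (D : ℂ)⁻¹ := by
  have hD : D ≠ 0 := ne_zero_of_dvd_ne_zero hN h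
  have hDC : (D : ℂ) ≠ 0 := by exact_mod_cast hD
  have hper : PeriodicMod (D : QuadOrder m)
      (fun r => if disc m ∣ r then (1 : ℂ) else 0) := by
    intro r μ
    have : disc m ∣ (D : QuadOrder m) * μ :=
      (Dvd.intro _ (disc_mul_disc_eq hm)).mul_right μ
    simp only [dvd_add_left this]
  rw [density, avg_eq_avg_of_dvd hN h hper, avg]
  simp only [disc_dvd_iff hD hm, trace_def, one_mul]
  have : ∀ x : ℕ, ∑ y ∈ Finset.range D, (if (D : ℤ) ∣ 2 * (x : ℤ) + (y : ℤ) then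
      (1 : ℂ) else 0) = 1 := by
    intro x
    simp_rw [add_comm (2 * (x : ℤ))]
    rw [sum_range_add_of_periodic (g := fun y => if (D : ℤ) ∣ y then (1 : ℂ) else 0)
      (fun y => by simp), sum_range_ite_dvd hD]
  simp_rw [this]
  simp
  field_simp

theorem density_natCast_mul_disc {N k : ℕ} (hN : N ≠ 0) (hm : (D : ℤ) = 4 * m + 1)
    (h : D * k ∣ N) : density N ((k : QuadOrder m) * disc m) = ((k : ℂ) ^ 2 * D)⁻¹ := by
  have hk : k ∣ N := dvd_of_mul_left_dvd h
  have hk0 : k ≠ 0 := ne_zero_of_dvd_ne_zero hN hk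
  have hd : (k : QuadOrder m) * disc m ∣ (N : QuadOrder m) := by
    refine dvd_trans ⟨disc m, ?_⟩ (Nat.cast_dvd_cast h)
    rw [mul_assoc, disc_mul_disc_eq hm, Nat.cast_mul, mul_comm]
  have hper : PeriodicMod (N : QuadOrder m)
      (fun r => if (k : QuadOrder m) * disc m ∣ r then (1 : ℂ) else 0) := by
    intro r μ
    simp only [dvd_add_left (hd.mul_right μ)]
  have := avg_ite_dvd hN (Nat.cast_dvd_cast hk) hper
  simp only [natCast_mul_dvd_natCast_mul_iff hk0] at this
  rw [density_natCast hN hk, ← density, density_disc hN hm (dvd_of_mul_right_dvd h)] at this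
  rw [mul_inv, ← this, density]
  congr 1
  funext r
  by_cases hr : (k : QuadOrder m) * disc m ∣ r
  · rw [if_pos hr, if_pos (dvd_of_mul_right_dvd hr)]
  · rw [if_neg hr, ite_self]

theorem sum_mul_density {N : ℕ} {c : QuadOrder m} (hc : c ∣ (N : QuadOrder m))
    {S : Finset (QuadOrder m)} (hS : ∀ y, ∃! s, s ∈ S ∧ c ∣ y - s)
    {f : QuadOrder m → ℂ} (hf : PeriodicMod c f) :
    (∑ s ∈ S, f s) * density N c = avg N f := by
  have hper : PeriodicMod (N : QuadOrder m) (fun r => if c ∣ r then (1 : ℂ) else 0) := by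
    intro r μ
    simp only [dvd_add_left (hc.mul_right μ)]
  have h1 : ∀ s, f s * density N c = avg N (fun r => if c ∣ r - s then f r else 0) := by
    intro s
    rw [density, ← avg_add_right hper (-s), ← avg_mul_left]
    congr 1
    funext r
    rw [← sub_eq_add_neg]
    split_ifs with h
    · obtain ⟨t, ht⟩ := h
      rw [mul_one, eq_add_of_sub_eq' ht, hf]
    · rw [mul_zero]
  rw [Finset.sum_mul]
  simp_rw [h1]
  rw [← avg_sum]
  congr 1
  funext r
  obtain ⟨s, ⟨hs, hd⟩, huniq⟩ := hS r
  rw [Finset.sum_eq_single_of_mem s hs, if_pos hd]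
  intro t ht hts
  exact if_neg fun h => hts (huniq t ⟨ht, h⟩)

theorem avg_avg_of_isCoprime {N : ℕ} (hN : N ≠ 0) {p c : QuadOrder m} (h : IsCoprime p c)
    {f : QuadOrder m → ℂ} (hf : PeriodicMod (N : QuadOrder m) f) :
    avg N (fun u => avg N (fun v => f (p * u + c * v))) = avg N f := by
  obtain ⟨α, β, hαβ⟩ := h
  have hv : ∀ w, PeriodicMod (N : QuadOrder m) (fun v => f (w + c * v)) := by
    intro w r μ
    simp only
    rw [mul_add, mul_left_comm, ← add_assoc, hf]
  have hu : PeriodicMod (N : QuadOrder m) (fun u => avg N (fun v => f (p * u + c * v))) := by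
    intro r μ
    simp only
    congr 1
    funext v
    rw [mul_add, mul_left_comm, add_right_comm, hf]
  have key : ∀ r, avg N (fun u => avg N (fun v => f (p * u + c * v))) =
      avg N (fun u => avg N (fun v => f (r + (p * u + c * v)))) := by
    intro r
    rw [← avg_add_right hu (α * r)]
    congr 1
    funext u
    rw [← avg_add_right (hv _) (β * r)]
    congr 1
    funext v
    congr 1
    linear_combination r * hαβ
  rw [← avg_const (m := m) hN (avg N _)]
  calc _ = avg N (fun r => avg N (fun u => avg N (fun v => f (r + (p * u + c * v))))) := by
        congr 1; funext r; exact key r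
    _ = avg N (fun u => avg N (fun v => avg N (fun r => f (r + (p * u + c * v))))) := by
        rw [avg_comm]
        congr 1; funext u; rw [avg_comm]
    _ = avg N f := by
        simp_rw [avg_add_right hf]
        rw [avg_const hN, avg_const hN]

end QuadOrder

namespace QuadOrder

open QuadraticAlgebra

variable {m : ℤ}

theorem norm_add_natCast_mul (r μ : QuadOrder m) (c : ℕ) :
    norm (r + (c : QuadOrder m) * μ) = norm r + c * (trace (μ * star r) + c * norm μ) := by
  simp [norm_def, trace_def]; ring

theorem norm_add_natCast_mul_disc_mul (r μ : QuadOrder m) (c : ℕ) :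
    norm (r + (c : QuadOrder m) * disc m * μ) =
      norm r + c * trace (disc m * μ * star r) - c ^ 2 * (4 * m + 1) * norm μ := by
  simp [norm_def, trace_def, disc]; ring

theorem natCast_dvd_star_iff {k : ℕ} {z : QuadOrder m} :
    (k : QuadOrder m) ∣ star z ↔ (k : QuadOrder m) ∣ z := by
  have key : ∀ z : QuadOrder m, (k : QuadOrder m) ∣ z → (k : QuadOrder m) ∣ star z := by
    rintro _ ⟨w, rfl⟩
    exact ⟨star w, by rw [star_mul', star_natCast]⟩
  exact ⟨fun h => by simpa using key _ h, key z⟩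

theorem isCoprime_intCast {x y : ℤ} (h : IsCoprime x y) :
    IsCoprime (x : QuadOrder m) (y : QuadOrder m) := by
  simpa using h.map (Int.castRingHom (QuadOrder m))

theorem norm_periodicMod {c : ℕ} (t : ℤ) :
    PeriodicMod (c : QuadOrder m) (fun r => expMod c (t * norm r)) := by
  intro r μ
  refine expMod_congr ?_
  rw [norm_add_natCast_mul]
  exact ⟨t * (trace (μ * star r) + c * norm μ), by ring⟩

theorem avg_expMod_norm_zmod {p N : ℕ} [NeZero p] (hN : N ≠ 0) (h : p ∣ N) (t : ℤ) :
    avg N (fun r : QuadOrder m => expMod p (t * norm r)) = ((p : ℂ) ^ 2)⁻¹ *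
      ∑ u : ZMod p, ∑ v : ZMod p,
        ZMod.stdAddChar ((t : ZMod p) * (u ^ 2 + u * v - (m : ZMod p) * v ^ 2)) := by
  rw [avg_eq_avg_of_dvd hN h (norm_periodicMod t), avg]
  congr 1
  rw [← sum_range_natCast_zmod p (fun u => ∑ v : ZMod p,
    ZMod.stdAddChar ((t : ZMod p) * (u ^ 2 + u * v - (m : ZMod p) * v ^ 2)))]
  refine Finset.sum_congr rfl fun x _ => ?_
  rw [← sum_range_natCast_zmod p (fun v =>
    ZMod.stdAddChar ((t : ZMod p) * ((x : ZMod p) ^ 2 + (x : ZMod p) * v - (m : ZMod p) * v ^ 2)))]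
  refine Finset.sum_congr rfl fun y _ => ?_
  rw [expMod_eq_stdAddChar, norm_def]
  congr 1
  push_cast
  ring

variable {D : ℕ} [hD : Fact D.Prime]

theorem legendreSym_neg (hD4 : D % 4 = 1) (t : ℤ) : legendreSym D (-t) = legendreSym D t := by
  have h2 : D ≠ 2 := by rintro rfl; norm_num at hD4
  rw [← neg_one_mul, legendreSym.mul, legendreSym.at_neg_one h2, ZMod.χ₄_nat_one_mod_four hD4,
    one_mul]

/-- The normalised quadratic Gauss sum of the norm form modulo `D * a`. -/
theorem avg_expMod_norm (hD4 : D % 4 = 1) (hm : (D : ℤ) = 4 * m + 1) {N : ℕ} (hN : N ≠ 0) {a : ℕ}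
    (h : D * a ∣ N) {t : ℤ} (ht : IsCoprime t (D * a : ℕ)) :
    avg N (fun r : QuadOrder m => expMod (D * a) (t * norm r)) =
      (legendreSym D t : ℂ) / (a * (Real.sqrt D : ℂ)) := by
  have hD0 : D ≠ 0 := hD.out.ne_zero
  have hDC : (D : ℂ) ≠ 0 := by exact_mod_cast hD0
  have hsq : (Real.sqrt D : ℂ) * Real.sqrt D = D := by
    rw [← Complex.ofReal_mul, Real.mul_self_sqrt (Nat.cast_nonneg D), Complex.ofReal_natCast]
  have hsq0 : (Real.sqrt D : ℂ) ≠ 0 := fun h => hDC (by rw [← hsq, h, zero_mul])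
  induction a using Nat.strong_induction_on generalizing t with
  | _ a ih =>
  have ha0 : a ≠ 0 := by
    rintro rfl
    exact hN (Nat.eq_zero_of_zero_dvd (by simpa using h))
  have htD : IsCoprime t (D : ℤ) := by
    rw [Nat.cast_mul] at ht; exact ht.of_mul_right_left
  have hper := norm_periodicMod (m := m) (c := D * a) t
  have hperN := hper.of_dvd (Nat.cast_dvd_cast h)
  by_cases hDa : D ∣ a
  · obtain ⟨b, rfl⟩ := hDa
    have hb0 : b ≠ 0 := right_ne_zero_of_mul ha0
    have hDN : D ∣ N := dvd_of_mul_right_dvd h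
    have hbN : D * b ∣ N := dvd_of_mul_left_dvd h
    have htb : IsCoprime (-t) (D * b : ℕ) := by
      rw [Nat.cast_mul] at ht
      exact ht.of_mul_right_right.neg_left
    have hdisc : ∀ r : QuadOrder m,
        (D : QuadOrder m) ∣ disc m * ((t : QuadOrder m) * star r) ↔ disc m ∣ r := by
      intro r
      rw [natCast_dvd_disc_mul_iff_disc_dvd hD0 hm, disc_dvd_iff hD0 hm, disc_dvd_iff hD0 hm,
        trace_intCast_mul, trace_star]
      exact ⟨htD.symm.dvd_of_dvd_mul_left, fun h => h.mul_left t⟩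
    rw [avg_eq_avg_ite_dvd hD0 hN hDN hperN ((D * b : ℕ) : QuadOrder m)
      (fun r => (t : QuadOrder m) * star r)]
    · simp only [hdisc]
      rw [avg_ite_dvd hN _ hperN, density_disc hN hm hDN]
      · have hG := ih b (lt_mul_of_one_lt_left (Nat.pos_of_ne_zero hb0) hD.out.one_lt) hbN htb
        have : ∀ s : QuadOrder m, expMod (D * (D * b)) (t * norm (disc m * s)) =
            expMod (D * b) (-t * norm s) := by
          intro s
          rw [map_mul, norm_disc, ← hm, ← expMod_mul_left hD0 (D * b)]
          congr 1
          ring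
        simp_rw [this]
        rw [hG, legendreSym_neg hD4]
        push_cast
        field_simp
      · exact (Dvd.intro _ (disc_mul_disc_eq hm)).trans (Nat.cast_dvd_cast hDN)
    · intro r μ
      rw [← expMod_mul_right (k := D * b) (mul_ne_zero hD0 hb0) D, ← expMod_add]
      refine expMod_congr ⟨t * b * norm μ, ?_⟩
      rw [norm_add_natCast_mul, mul_left_comm, trace_intCast_mul]
      push_cast
      ring
  by_cases ha1 : a = 1
  · subst ha1
    have ht0 : (t : ZMod D) ≠ 0 := by
      rw [Ne, ZMod.intCast_zmod_eq_zero_iff_dvd]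
      intro hdvd
      have := htD.symm.isUnit_of_dvd' dvd_rfl hdvd
      exact hD.out.one_lt.ne' (by simpa using Int.isUnit_iff_natAbs_eq.mp this)
    have h1 := avg_expMod_norm_zmod (m := m) hN (dvd_of_mul_right_dvd h) t
    rw [sum_stdAddChar_form_self hD4 hm ht0] at h1
    rw [mul_one, h1]
    simp only [Nat.cast_one, one_mul]
    rw [← hsq]
    field_simp
  obtain ⟨p, hp, hpa⟩ := Nat.exists_prime_and_dvd ha1
  have hpD : p ≠ D := by rintro rfl; exact hDa hpa
  obtain ⟨c, rfl⟩ := hpa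
  have hp0 : p ≠ 0 := hp.ne_zero
  have hpC : (p : ℂ) ≠ 0 := by exact_mod_cast hp0
  by_cases hpc : p ∣ c
  · obtain ⟨b, rfl⟩ := hpc
    have hb0 : b ≠ 0 := right_ne_zero_of_mul (right_ne_zero_of_mul ha0)
    have hDpN : D * p ∣ N := dvd_of_mul_right_dvd (b := p * b) (by rwa [mul_assoc])
    have hpN : p ∣ N := dvd_of_mul_left_dvd hDpN
    have hbN : D * b ∣ N := (mul_dvd_mul_left D ⟨p * p, by ring⟩).trans h
    have htb : IsCoprime t (D * b : ℕ) := by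
      refine ht.of_isCoprime_of_dvd_right (Int.natCast_dvd_natCast.mpr ?_)
      exact mul_dvd_mul_left D ⟨p * p, by ring⟩
    have htp : IsCoprime (p : QuadOrder m) (t : QuadOrder m) := by
      have : IsCoprime t (p : ℤ) :=
        ht.of_isCoprime_of_dvd_right (Int.natCast_dvd_natCast.mpr ⟨D * (p * b), by ring⟩)
      simpa using isCoprime_intCast (m := m) this.symm
    have hdiv : ∀ r : QuadOrder m, ((D * p : ℕ) : QuadOrder m) ∣
        disc m * (disc m * ((t : QuadOrder m) * star r)) ↔ (p : QuadOrder m) ∣ r := by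
      intro r
      rw [← mul_assoc, disc_mul_disc_eq hm, Nat.cast_mul, natCast_mul_dvd_natCast_mul_iff hD0,
        ← natCast_dvd_star_iff (z := r)]
      exact ⟨htp.dvd_of_dvd_mul_left, fun h => h.mul_left _⟩
    rw [avg_eq_avg_ite_dvd (mul_ne_zero hD0 hp0) hN hDpN hperN (((p * b : ℕ) : QuadOrder m) * disc m)
      (fun r => disc m * ((t : QuadOrder m) * star r))]
    · simp only [hdiv]
      rw [avg_ite_dvd hN (Nat.cast_dvd_cast hpN) hperN, density_natCast hN hpN]
      have hG := ih b ((lt_mul_of_one_lt_left (Nat.pos_of_ne_zero hb0) hp.one_lt).trans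
        (lt_mul_of_one_lt_left (Nat.pos_of_ne_zero (mul_ne_zero hp0 hb0)) hp.one_lt)) hbN htb
      have : ∀ s : QuadOrder m, expMod (D * (p * (p * b))) (t * norm ((p : QuadOrder m) * s)) =
          expMod (D * b) (t * norm s) := by
        intro s
        rw [map_mul, QuadraticAlgebra.norm_natCast, ← expMod_mul_left (mul_ne_zero hp0 hp0) (D * b)]
        congr 1
        · ring
        · push_cast; ring
      simp_rw [this]
      rw [hG]
      push_cast
      field_simp
    · intro r μ
      rw [show D * (p * (p * b)) = D * p * (p * b) by ring,
        ← expMod_mul_right (k := p * b) (mul_ne_zero hp0 hb0) (D * p), ← expMod_add]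
      refine expMod_congr ⟨-(t * b * norm μ), ?_⟩
      rw [norm_add_natCast_mul_disc_mul, ← hm,
        show μ * (disc m * ((t : QuadOrder m) * star r)) =
          (t : QuadOrder m) * (disc m * μ * star r) by ring, trace_intCast_mul]
      push_cast
      ring
  · have : Fact p.Prime := ⟨hp⟩
    have hc0 : c ≠ 0 := right_ne_zero_of_mul ha0
    have hcN : D * c ∣ N := (mul_dvd_mul_left D (Dvd.intro_left p rfl)).trans h
    have hpN : p ∣ N := dvd_trans ⟨D * c, by ring⟩ h
    have hpDc : IsCoprime (p : ℤ) (D * c : ℕ) := by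
      rw [Nat.isCoprime_iff_coprime, hp.coprime_iff_not_dvd, hp.dvd_mul, not_or]
      exact ⟨fun h => hpD ((Nat.prime_dvd_prime_iff_eq hp hD.out).mp h), hpc⟩
    have htp : IsCoprime (t * p) (D * c : ℕ) :=
      (ht.of_isCoprime_of_dvd_right (Int.natCast_dvd_natCast.mpr ⟨p, by ring⟩)).mul_left hpDc
    have htc : ((-t * c : ℤ) : ZMod p) ≠ 0 := by
      rw [Ne, ZMod.intCast_zmod_eq_zero_iff_dvd]
      intro hdvd
      have h1 : IsCoprime (-t * c) (p : ℤ) := by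
        refine IsCoprime.mul_left ?_ (hpDc.of_isCoprime_of_dvd_right
          (Int.natCast_dvd_natCast.mpr (dvd_mul_left c D))).symm
        exact (ht.of_isCoprime_of_dvd_right
          (Int.natCast_dvd_natCast.mpr ⟨D * c, by ring⟩)).neg_left
      have := h1.symm.isUnit_of_dvd' dvd_rfl hdvd
      exact hp.one_lt.ne' (by simpa using Int.isUnit_iff_natAbs_eq.mp this)
    have hcop : IsCoprime (p : QuadOrder m) ((c : QuadOrder m) * disc m) := by
      have := isCoprime_intCast (m := m) hpDc
      simp only [Int.cast_mul, Int.cast_natCast, Nat.cast_mul] at this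
      rw [← disc_mul_disc_eq hm, mul_assoc, mul_comm (disc m) (c : QuadOrder m)] at this
      exact this.of_mul_right_right
    rw [← avg_avg_of_isCoprime hN hcop hperN]
    have hsplit : ∀ u v : QuadOrder m, expMod (D * (p * c))
        (t * norm ((p : QuadOrder m) * u + (c : QuadOrder m) * disc m * v)) =
        expMod (D * c) (t * p * norm u) * expMod p (-t * c * norm v) := by
      intro u v
      rw [← expMod_mul_left hp0 (D * c), ← expMod_mul_left (mul_ne_zero hD0 hc0) p,
        show p * (D * c) = D * (p * c) by ring, show D * c * p = D * (p * c) by ring, ← expMod_add]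
      refine expMod_congr ⟨t * (v * star u).im, ?_⟩
      rw [norm_add_natCast_mul_disc_mul, star_mul', star_natCast,
        show disc m * v * ((p : QuadOrder m) * star u) =
          (p : QuadOrder m) * (disc m * (v * star u)) by ring, trace_natCast_mul, trace_disc_mul,
        map_mul, QuadraticAlgebra.norm_natCast, ← hm]
      push_cast
      ring
    simp_rw [hsplit, avg_mul_left, mul_comm (expMod (D * c) _), avg_mul_left]
    rw [ih c (lt_mul_of_one_lt_left (Nat.pos_of_ne_zero hc0) hp.one_lt) hcN htp,
      avg_expMod_norm_zmod hN hpN, sum_stdAddChar_form_of_ne hD4 hpD hm htc, legendreSym.mul]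
    have hleg : (legendreSym D p : ℂ) * legendreSym D p = 1 := by
      have : ((p : ℤ) : ZMod D) ≠ 0 := by
        rw [Int.cast_natCast, Ne, ZMod.natCast_eq_zero_iff]
        exact fun h => hpD ((Nat.prime_dvd_prime_iff_eq hD.out hp).mp h).symm
      have := legendreSym.sq_one D this
      rw [sq] at this
      exact_mod_cast this
    have hcC : (c : ℂ) ≠ 0 := by exact_mod_cast hc0
    push_cast
    field_simp
    linear_combination (legendreSym D t : ℂ) * hleg

end QuadOrder

theorem sum_range_eq_sum_divisors {n : ℕ} (hn : n ≠ 0) (F : ℕ → ℂ) :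
    ∑ t ∈ Finset.range n, F t = ∑ g ∈ n.divisors,
      ∑ x ∈ (Finset.range (n / g)).filter (fun x => Nat.Coprime x (n / g)), F (g * x) := by
  rw [← Finset.sum_fiberwise_of_maps_to (s := Finset.range n) (t := n.divisors)
    (g := fun t => n.gcd t) (fun t _ => Nat.mem_divisors.mpr ⟨Nat.gcd_dvd_left n t, hn⟩)]
  refine Finset.sum_congr rfl fun g hg => ?_
  obtain ⟨k, rfl⟩ := (Nat.mem_divisors.mp hg).1
  have hg0 : 0 < g := Nat.pos_of_ne_zero (left_ne_zero_of_mul hn)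
  rw [Nat.mul_div_cancel_left k hg0]
  symm
  refine Finset.sum_bij (fun x _ => g * x) ?_ ?_ ?_ (fun _ _ => rfl)
  · intro x hx
    rw [Finset.mem_filter, Finset.mem_range] at hx ⊢
    refine ⟨Nat.mul_lt_mul_of_pos_left hx.1 hg0, ?_⟩
    rw [Nat.gcd_mul_left, Nat.gcd_comm, hx.2, mul_one]
  · intro x _ y _ h
    exact Nat.eq_of_mul_eq_mul_left hg0 h
  · intro t ht
    rw [Finset.mem_filter, Finset.mem_range] at ht
    obtain ⟨x, rfl⟩ : g ∣ t := ht.2 ▸ Nat.gcd_dvd_right _ t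
    refine ⟨x, ?_, rfl⟩
    rw [Finset.mem_filter, Finset.mem_range]
    refine ⟨Nat.lt_of_mul_lt_mul_left ht.1, ?_⟩
    have := ht.2
    rw [Nat.gcd_mul_left, Nat.mul_eq_left hg0.ne'] at this
    rwa [Nat.Coprime, Nat.gcd_comm]

theorem SD_eq_sum_expMod (D : ℕ) [Fact D.Prime] (u w : ℤ) (c : ℕ) :
    SD D u w c = ∑ x ∈ (Finset.range c).filter (fun x => Nat.Coprime x c),
      (legendreSym D (x : ℤ) : ℂ) * expMod c (u * (((x : ZMod c)⁻¹).val : ℤ) + w * (x : ℤ)) :=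
  rfl

namespace QuadOrder

open QuadraticAlgebra

variable {m : ℤ} {D : ℕ}

theorem norm_add_mul_disc_modEq (hm : (D : ℤ) = 4 * m + 1) (a : ℕ) (r μ : QuadOrder m) :
    ((D * a : ℕ) : ℤ) ∣ norm (r + (a : QuadOrder m) * disc m * μ) - norm r := by
  rw [norm_add_natCast_mul_disc_mul, mul_assoc (disc m), trace_disc_mul, ← hm]
  refine ⟨(μ * star r).im - a * norm μ, ?_⟩
  push_cast
  ring

theorem trace_natCast_mul_disc_mul (hm : (D : ℤ) = 4 * m + 1) (a : ℕ) (μ : QuadOrder m) :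
    ((D * a : ℕ) : ℤ) ∣ trace ((a : QuadOrder m) * disc m * μ) := by
  rw [mul_assoc, trace_natCast_mul, trace_disc_mul, ← hm]
  exact ⟨μ.im, by push_cast; ring⟩

theorem periodicMod_phase (hm : (D : ℤ) = 4 * m + 1) (a : ℕ) (t : ℤ) (l : QuadOrder m) :
    PeriodicMod ((a : QuadOrder m) * disc m)
      (fun r => expMod (D * a) (-t * norm r + trace (r * l))) := by
  intro r μ
  refine expMod_congr ?_
  rw [add_mul, LinearMap.map_add, mul_assoc _ μ l]
  exact (dvd_add ((norm_add_mul_disc_modEq hm a r μ).mul_left (-t))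
    (trace_natCast_mul_disc_mul hm a (μ * l))).trans (dvd_of_eq (by ring))

theorem natCast_mul_disc_dvd (hm : (D : ℤ) = 4 * m + 1) (a : ℕ) :
    (a : QuadOrder m) * disc m ∣ ((D * a : ℕ) : QuadOrder m) :=
  ⟨disc m, by rw [mul_assoc, disc_mul_disc_eq hm, Nat.cast_mul, mul_comm]⟩

variable [hD : Fact D.Prime]

theorem avg_phase_eq_zero_of_not_dvd (hm : (D : ℤ) = 4 * m + 1) {a g : ℕ} (ha : a ≠ 0)
    (hg : g ∣ D * a) (hga : ¬ g ∣ a) (x : ℤ) {l : QuadOrder m} (hl : ¬ disc m ∣ l) :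
    avg (D * a) (fun r => expMod (D * a) (-(g * x) * norm r + trace (r * l))) = 0 := by
  have hD0 : D ≠ 0 := hD.out.ne_zero
  have hn : D * a ≠ 0 := mul_ne_zero hD0 ha
  have hDg : D ∣ g := by
    by_contra h
    exact hga (((Nat.Prime.coprime_iff_not_dvd hD.out).mpr h).symm.dvd_of_dvd_mul_left hg)
  have hg0 : g ≠ 0 := ne_zero_of_dvd_ne_zero hn hg
  have hper := (periodicMod_phase hm a (g * x) l).of_dvd (natCast_mul_disc_dvd hm a)
  obtain ⟨k, hk⟩ := id hg
  have hk0 : k ≠ 0 := by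
    rintro rfl
    exact hn (by rw [hk, mul_zero])
  rw [avg_eq_avg_ite_dvd hg0 hn hg hper (k : QuadOrder m) (fun _ => l)]
  · have : ¬ (g : QuadOrder m) ∣ disc m * l := fun h =>
      hl ((natCast_dvd_disc_mul_iff_disc_dvd hD0 hm).mp ((Nat.cast_dvd_cast hDg).trans h))
    simp only [if_neg this]
    exact avg_const hn 0
  · intro r μ
    rw [hk, ← expMod_mul_right hk0 g, ← expMod_add]
    refine expMod_congr ⟨-x * (trace (μ * star r) + k * norm μ), ?_⟩
    rw [norm_add_natCast_mul, add_mul, LinearMap.map_add, mul_assoc _ μ l, trace_natCast_mul]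
    push_cast
    ring

theorem avg_phase_eq_zero_of_not_dvd_right (hm : (D : ℤ) = 4 * m + 1) {a g : ℕ} (ha : a ≠ 0)
    (hg : g ∣ a) (x : ℤ) {l : QuadOrder m} (hl : ¬ (g : QuadOrder m) ∣ l) :
    avg (D * a) (fun r => expMod (D * a) (-(g * x) * norm r + trace (r * l))) = 0 := by
  have hD0 : D ≠ 0 := hD.out.ne_zero
  have hn : D * a ≠ 0 := mul_ne_zero hD0 ha
  have hg0 : g ≠ 0 := ne_zero_of_dvd_ne_zero ha hg
  have hper := (periodicMod_phase hm a (g * x) l).of_dvd (natCast_mul_disc_dvd hm a)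
  have hDg : D * g ∣ D * a := mul_dvd_mul_left D hg
  obtain ⟨k, rfl⟩ := hg
  have hk0 : k ≠ 0 := right_ne_zero_of_mul ha
  rw [avg_eq_avg_ite_dvd (mul_ne_zero hD0 hg0) hn hDg hper ((k : QuadOrder m) * disc m)
    (fun _ => disc m * l)]
  · have : ¬ ((D * g : ℕ) : QuadOrder m) ∣ disc m * (disc m * l) := by
      rwa [← mul_assoc, disc_mul_disc_eq hm, Nat.cast_mul, natCast_mul_dvd_natCast_mul_iff hD0]
    simp only [if_neg this]
    exact avg_const hn 0
  · intro r μ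
    rw [← mul_assoc D g k, ← expMod_mul_right hk0 (D * g), ← expMod_add]
    obtain ⟨q, hq⟩ := norm_add_mul_disc_modEq hm k r μ
    refine expMod_congr ⟨-x * q, ?_⟩
    rw [sub_eq_iff_eq_add] at hq
    rw [hq, add_mul, LinearMap.map_add, mul_assoc _ μ l, mul_assoc _ (disc m), trace_natCast_mul,
      mul_left_comm (disc m)]
    push_cast
    ring

theorem avg_phase_natCast_mul (hD4 : D % 4 = 1) (hm : (D : ℤ) = 4 * m + 1) {g k : ℕ}
    (hg : g ≠ 0) (hk : k ≠ 0) {x y : ℤ} (hxy : ((D * k : ℕ) : ℤ) ∣ x * y - 1) (l : QuadOrder m) :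
    avg (D * (g * k)) (fun r => expMod (D * (g * k))
        (-(g * x) * norm r + trace (r * ((g : QuadOrder m) * l)))) =
      expMod (D * k) (y * norm l) * ((legendreSym D x : ℂ) / (k * (Real.sqrt D : ℂ))) := by
  have hD0 : D ≠ 0 := hD.out.ne_zero
  have hn : D * (g * k) ≠ 0 := mul_ne_zero hD0 (mul_ne_zero hg hk)
  have hdvd : D * k ∣ D * (g * k) := mul_dvd_mul_left D (dvd_mul_left k g)
  have hx : IsCoprime (-x) ((D * k : ℕ) : ℤ) := by
    obtain ⟨q, hq⟩ := hxy
    exact IsCoprime.neg_left ⟨y, -q, by linear_combination hq⟩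
  have hper : PeriodicMod ((D * (g * k) : ℕ) : QuadOrder m)
      (fun r => expMod (D * k) (-x * norm r)) :=
    (norm_periodicMod (-x)).of_dvd (Nat.cast_dvd_cast hdvd)
  rw [← legendreSym_neg hD4 x, ← avg_expMod_norm hD4 hm hn hdvd hx,
    ← avg_add_right hper (-((y : QuadOrder m) * star l)), ← avg_mul_left]
  congr 1
  funext r
  rw [← expMod_add, show D * (g * k) = g * (D * k) by ring,
    show -(g * x) * norm r + trace (r * ((g : QuadOrder m) * l)) =
      g * (-x * norm r + trace (r * l)) by
        rw [mul_left_comm, trace_natCast_mul]; ring, expMod_mul_left hg]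
  refine expMod_congr ?_
  have h1 : norm (r + -((y : QuadOrder m) * star l)) =
      norm r - y * trace (r * l) + y ^ 2 * norm l := by
    rw [norm_add, QuadraticAlgebra.norm_neg, MonoidHom.map_mul, QuadraticAlgebra.norm_intCast,
      QuadraticAlgebra.norm_star,
      neg_mul, LinearMap.map_neg, mul_assoc, trace_intCast_mul, ← star_mul', trace_star, mul_comm l r,
      Int.cast_id]
    ring
  rw [h1]
  obtain ⟨q, hq⟩ := hxy
  refine ⟨q * (y * norm l - trace (r * l)), ?_⟩
  linear_combination (y * norm l - trace (r * l)) * hq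

theorem sum_expMod_trace_eq (hD4 : D % 4 = 1) (hm : (D : ℤ) = 4 * m + 1) {a : ℕ} (ha : a ≠ 0)
    {l : QuadOrder m} (hl : ¬ disc m ∣ l) {S : Finset (QuadOrder m)}
    (hS : ∀ y, ∃! s, s ∈ S ∧ (a : QuadOrder m) * disc m ∣ y - s) :
    ∑ s ∈ S.filter (fun s : QuadOrder m => ((D * a : ℕ) : ℤ) ∣ norm s - 1),
        expMod (D * a) (trace (s * l)) =
      (1 / (Real.sqrt D : ℂ)) *
        ∑ r ∈ (Nat.divisors a).filter (fun r : ℕ => (r : QuadOrder m) ∣ l),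
          (r : ℂ) * SD D (norm l / (r : ℤ) ^ 2) 1 (D * a / r) := by
  have hD0 : D ≠ 0 := hD.out.ne_zero
  have hn : D * a ≠ 0 := mul_ne_zero hD0 ha
  have hDC : (D : ℂ) ≠ 0 := by exact_mod_cast hD0
  have haC : (a : ℂ) ≠ 0 := by exact_mod_cast ha
  have hdetect : ∀ s : QuadOrder m,
      (if ((D * a : ℕ) : ℤ) ∣ norm s - 1 then expMod (D * a) (trace (s * l)) else 0) =
      ((D * a : ℕ) : ℂ)⁻¹ * ∑ t ∈ Finset.range (D * a),
        expMod (D * a) t * expMod (D * a) (-t * norm s + trace (s * l)) := by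
    intro s
    have h1 : ∀ t : ℕ, expMod (D * a) t * expMod (D * a) (-t * norm s + trace (s * l)) =
        expMod (D * a) (t * (1 - norm s)) * expMod (D * a) (trace (s * l)) := by
      intro t
      rw [← expMod_add, ← expMod_add]
      congr 1
      ring
    simp_rw [h1]
    rw [← Finset.sum_mul, sum_range_expMod_mul hn]
    have : ((D * a : ℕ) : ℂ) ≠ 0 := by exact_mod_cast hn
    by_cases h : ((D * a : ℕ) : ℤ) ∣ norm s - 1
    · rw [if_pos h, if_pos (dvd_sub_comm.mp h)]
      field_simp
    · rw [if_neg h, if_neg (fun h' => h (dvd_sub_comm.mp h'))]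
      simp
  have hphase : ∀ t : ℤ, ∑ s ∈ S, expMod (D * a) (-t * norm s + trace (s * l)) =
      a ^ 2 * D * avg (D * a) (fun r => expMod (D * a) (-t * norm r + trace (r * l))) := by
    intro t
    rw [← sum_mul_density (natCast_mul_disc_dvd hm a) hS (periodicMod_phase hm a t l),
      density_natCast_mul_disc hn hm dvd_rfl]
    field_simp
  rw [Finset.sum_filter]
  simp_rw [hdetect]
  rw [← Finset.mul_sum, Finset.sum_comm]
  simp_rw [← Finset.mul_sum, hphase]
  rw [sum_range_eq_sum_divisors hn, Finset.mul_sum, Finset.mul_sum]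
  symm
  refine Finset.sum_subset_zero_on_sdiff ?_ ?_ ?_
  · intro r hr
    rw [Finset.mem_filter, Nat.mem_divisors] at hr
    exact Nat.mem_divisors.mpr ⟨hr.1.1.mul_left D, hn⟩
  · intro g hg
    rw [Finset.mem_sdiff, Finset.mem_filter, Nat.mem_divisors, Nat.mem_divisors] at hg
    refine mul_eq_zero_of_right _ (Finset.sum_eq_zero fun x _ => ?_)
    refine mul_eq_zero_of_right _ (mul_eq_zero_of_right _ ?_)
    push_cast
    by_cases hga : g ∣ a
    · exact avg_phase_eq_zero_of_not_dvd_right hm ha hga x fun h => hg.2 ⟨⟨hga, ha⟩, h⟩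
    · exact avg_phase_eq_zero_of_not_dvd hm ha hg.1.1 hga x hl
  · intro g hg
    rw [Finset.mem_filter, Nat.mem_divisors] at hg
    obtain ⟨⟨⟨k, rfl⟩, -⟩, ⟨w, rfl⟩⟩ := hg
    have hg0 : g ≠ 0 := left_ne_zero_of_mul ha
    have hk0 : k ≠ 0 := right_ne_zero_of_mul ha
    have hgC : (g : ℂ) ≠ 0 := by exact_mod_cast hg0
    have hkC : (k : ℂ) ≠ 0 := by exact_mod_cast hk0
    have hdiv : D * (g * k) / g = D * k := by
      rw [mul_left_comm, Nat.mul_div_cancel_left _ (Nat.pos_of_ne_zero hg0)]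
    have hnorm : norm ((g : QuadOrder m) * w) / (g : ℤ) ^ 2 = norm w := by
      rw [map_mul, QuadraticAlgebra.norm_natCast]
      exact Int.mul_ediv_cancel_left _ (pow_ne_zero 2 (by exact_mod_cast hg0))
    rw [hdiv, hnorm, SD_eq_sum_expMod, Finset.mul_sum, Finset.mul_sum, Finset.mul_sum]
    refine Finset.sum_congr rfl fun x hx => ?_
    have hcop := (Finset.mem_filter.mp hx).2
    have hxy : ((D * k : ℕ) : ℤ) ∣ (x : ℤ) * (((x : ZMod (D * k))⁻¹).val : ℤ) - 1 := by
      have : NeZero (D * k) := ⟨mul_ne_zero hD0 hk0⟩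
      rw [← ZMod.intCast_zmod_eq_zero_iff_dvd]
      push_cast
      rw [ZMod.natCast_val, ZMod.cast_id', id, ZMod.coe_mul_inv_eq_one x hcop, sub_self]
    have hmain := avg_phase_natCast_mul hD4 hm hg0 hk0 hxy w
    have hphase_g : expMod (D * (g * k)) (g * x) = expMod (D * k) x := by
      rw [show D * (g * k) = g * (D * k) by ring, expMod_mul_left hg0]
    rw [Nat.cast_mul (α := ℤ) g x, hmain, hphase_g, expMod_add, mul_comm (norm w), one_mul]
    push_cast
    field_simp

end QuadOrder

/-- A domain of characteristic zero with an involution whose fixed ring is `ℤ`, containing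
`δ = √D` and `(1 + δ) / 2`, is the quadratic order of discriminant `D = 4 * m + 1`. -/
theorem exists_ringEquiv_quadOrder {D : ℕ} [hDp : Fact D.Prime] {m : ℤ} (hm : (D : ℤ) = 4 * m + 1)
    {R : Type*} [CommRing R] [IsDomain R] [CharZero R] (σ : R ≃+* R)
    (hσσ : ∀ y : R, σ (σ y) = y) (hfix : ∀ y : R, σ y = y ↔ ∃ k : ℤ, y = (k : R))
    {δ ω : R} (hδ2 : δ ^ 2 = (D : R)) (hσδ : σ δ = -δ) (hω : 2 * ω = 1 + δ) :
    ∃ φ : QuadOrder m ≃+* R,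
      φ (QuadOrder.disc m) = δ ∧ ∀ z, σ (φ z) = φ (star z) := by
  have h2 : (2 : R) ≠ 0 := two_ne_zero
  have hD0 : (D : R) ≠ 0 := by exact_mod_cast hDp.out.ne_zero
  have hδ0 : δ ≠ 0 := by
    rintro rfl
    exact hD0 (by rw [← hδ2]; ring)
  have hmR : (D : R) = 4 * m + 1 := by exact_mod_cast congrArg (Int.cast : ℤ → R) hm
  have hωω : ω * ω = m • (1 : R) + (1 : ℤ) • ω := by
    rw [zsmul_eq_mul, mul_one, one_zsmul]
    apply mul_left_cancel₀ (mul_ne_zero h2 h2)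
    linear_combination (2 * ω + δ - 1) * hω + hδ2 + hmR
  have hσω : σ ω = 1 - ω := by
    apply mul_left_cancel₀ h2
    have := congrArg σ hω
    rw [map_mul, map_add, map_one, hσδ, map_ofNat] at this
    linear_combination this + hω
  let φ := QuadraticAlgebra.lift (R := ℤ) (a := m) (b := 1) ⟨ω, hωω⟩
  have hφ : ∀ z, φ z = z.re + z.im * ω := by
    intro z
    simp [φ, QuadraticAlgebra.lift]
  have hσφ : ∀ z, σ (φ z) = φ (star z) := by
    intro z
    rw [hφ, hφ, map_add, map_mul, map_intCast, map_intCast, hσω]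
    simp
    ring
  have hinj : Function.Injective φ := by
    rw [injective_iff_map_eq_zero]
    intro z hz
    have hz' := hσφ z
    rw [hz, map_zero, hφ] at hz'
    rw [hφ] at hz
    simp at hz'
    have him : (z.im : R) * δ = 0 := by linear_combination hz + hz' - z.im * hω
    have him0 : z.im = 0 := by
      exact_mod_cast (mul_eq_zero.mp him).resolve_right hδ0
    rw [him0] at hz
    ext
    · simpa using hz
    · simpa using him0
  have hsurj : Function.Surjective φ := by
    intro y
    obtain ⟨k, hk⟩ := (hfix (δ * (y - σ y))).mp (by rw [map_mul, map_sub, hσσ, hσδ]; ring)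
    obtain ⟨j, hj⟩ := (hfix ((y - σ y) ^ 2)).mp (by rw [map_pow, map_sub, hσσ]; ring)
    have hkj : k ^ 2 = D * j := by
      have : (k : R) ^ 2 = D * j := by rw [← hk, ← hj, ← hδ2]; ring
      exact_mod_cast this
    obtain ⟨q, rfl⟩ : (D : ℤ) ∣ k :=
      (Nat.prime_iff_prime_int.mp hDp.out).dvd_of_dvd_pow ⟨j, hkj⟩
    have hq : y - σ y = δ * q := by
      apply mul_left_cancel₀ hδ0
      rw [hk, Int.cast_mul, Int.cast_natCast, ← hδ2]
      ring
    obtain ⟨i, hi⟩ := (hfix (y - q * ω)).mp (by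
      rw [map_sub, map_mul, map_intCast, hσω]
      linear_combination -hq + q * hω)
    refine ⟨⟨i, q⟩, ?_⟩
    rw [hφ]
    linear_combination -hi
  refine ⟨RingEquiv.ofBijective φ ⟨hinj, hsurj⟩, ?_, hσφ⟩
  change φ _ = δ
  rw [hφ]
  simp [QuadOrder.disc]
  linear_combination hω

/-- Model of the ring of integers `R = O_K` of `K = ℚ(√D)` (`D ≡ 1 (mod 4)`
prime, class number one): `R` is a principal ideal domain with an injective real embedding
`emb`, an involution `σ ≠ id` whose fixed ring is exactly `ℤ`, `δ² = D`, `σ δ = −δ`, and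
`(1+δ)/2 ∈ R`; `T` is the trace (`x + x' = T x`) and `Nrm` the norm (`x·x' = Nrm x`).

Let `a ≥ 1`, `n := D·a` and `l ∈ R` with `gcd(l, √D) = 1`.  Then
(i) `e(Tr(r·l)/n)` depends only on the class of `r` modulo `n/√D = a·δ`, and the condition
`r·r' ≡ 1 (mod n)` is invariant under `r ↦ r + μ·a·δ`;
(ii) for any complete set `S` of representatives of `R` modulo `a·δ`,
`Σ_{r ∈ S, r·r' ≡ 1 (n)} e(Tr(r·l)/n) = (1/√D)·Σ_{r ∈ ℕ, r ∣ l in R, r ∣ a} r·S_D(N(l)/r², 1, D·a/r)`. -/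
theorem stmt_9
    (D : ℕ) [hDp : Fact (Nat.Prime D)] (hD4 : D % 4 = 1)
    (R : Type) [CommRing R] [IsDomain R] [IsPrincipalIdealRing R]
    (emb : R →+* ℝ) (hemb : Function.Injective emb)
    (σ : R ≃+* R) (hσσ : ∀ y : R, σ (σ y) = y) (hσne : σ ≠ RingEquiv.refl R)
    (hfix : ∀ y : R, σ y = y ↔ ∃ k : ℤ, y = (k : R))
    (δ : R) (hδ2 : δ ^ 2 = (D : R)) (hσδ : σ δ = -δ)
    (hhalf : ∃ ω : R, 2 * ω = 1 + δ)
    (T Nrm : R → ℤ)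
    (hT : ∀ x : R, x + σ x = ((T x : ℤ) : R))
    (hN : ∀ x : R, x * σ x = ((Nrm x : ℤ) : R))
    (a : ℕ) (ha : 0 < a)
    (l : R) (hl : IsCoprime l δ) :
    -- (i) well-definedness modulo n/√D = a·δ
    (∀ r μ : R,
      (((D * a : ℕ) : R) ∣ r * σ r - 1 ↔
        ((D * a : ℕ) : R) ∣ (r + μ * ((a : R) * δ)) * σ (r + μ * ((a : R) * δ)) - 1) ∧
      (((D * a : ℕ) : R) ∣ r * σ r - 1 →
        e2pi ((T (r * l) : ℝ) / ((D * a : ℕ) : ℝ)) =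
          e2pi ((T ((r + μ * ((a : R) * δ)) * l) : ℝ) / ((D * a : ℕ) : ℝ)))) ∧
    -- (ii) the identity, for any complete set of representatives modulo a·δ
    (∀ S : Finset R,
      (∀ y : R, ∃! s : R, s ∈ S ∧ (a : R) * δ ∣ y - s) →
      ∑ s ∈ S.filter (fun s => ((D * a : ℕ) : R) ∣ s * σ s - 1),
          e2pi ((T (s * l) : ℝ) / ((D * a : ℕ) : ℝ)) =
        (1 / (Real.sqrt D : ℂ)) *
          ∑ r ∈ (Nat.divisors a).filter (fun r : ℕ => (↑r : R) ∣ l),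
            (r : ℂ) * SD D (Nrm l / (r : ℤ) ^ 2) 1 (D * a / r)) := by
  obtain ⟨m, hm⟩ : ∃ m : ℤ, (D : ℤ) = 4 * m + 1 := ⟨D / 4, by omega⟩
  obtain ⟨ω, hω⟩ := hhalf
  have : CharZero R := emb.charZero
  obtain ⟨φ, hφδ, hσφ⟩ := exists_ringEquiv_quadOrder hm σ hσσ hfix hδ2 hσδ hω
  have hTφ : ∀ z, T (φ z) = QuadraticAlgebra.trace z := by
    intro z
    have h : ((T (φ z) : ℤ) : R) = (QuadraticAlgebra.trace z : ℤ) := by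
      rw [← hT, hσφ, ← map_add, ← QuadraticAlgebra.algebraMap_trace_eq_add_star]
      simp
    exact_mod_cast h
  have hNφ : ∀ z, Nrm (φ z) = QuadraticAlgebra.norm z := by
    intro z
    have h : ((Nrm (φ z) : ℤ) : R) = (QuadraticAlgebra.norm z : ℤ) := by
      rw [← hN, hσφ, ← map_mul, ← QuadraticAlgebra.algebraMap_norm_eq_mul_star]
      simp
    exact_mod_cast h
  have hdvd : ∀ z, ((D * a : ℕ) : R) ∣ φ z * σ (φ z) - 1 ↔
      ((D * a : ℕ) : ℤ) ∣ QuadraticAlgebra.norm z - 1 := by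
    intro z
    have h1 : φ z * σ (φ z) - 1 = φ ((QuadraticAlgebra.norm z - 1 : ℤ) : QuadOrder m) := by
      rw [hN, hNφ, map_intCast]; push_cast; rfl
    have h2 : ((D * a : ℕ) : R) = φ ((D * a : ℕ) : QuadOrder m) := (map_natCast φ _).symm
    rw [h1, h2, map_dvd_iff φ, QuadOrder.natCast_dvd_iff]
    simp [QuadraticAlgebra.re_one, QuadraticAlgebra.im_one]
  have hmod : ∀ z w, φ z + φ w * ((a : R) * δ) =
      φ (z + (a : QuadOrder m) * QuadOrder.disc m * w) := by
    intro z w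
    rw [map_add, map_mul, map_mul, map_natCast, hφδ, mul_comm (φ w)]
  obtain ⟨l, rfl⟩ := φ.surjective l
  refine ⟨fun r μ => ?_, fun S hS => ?_⟩
  · obtain ⟨z, rfl⟩ := φ.surjective r
    obtain ⟨w, rfl⟩ := φ.surjective μ
    rw [hmod, hdvd, hdvd, ← map_mul, ← map_mul, hTφ, hTφ]
    refine ⟨?_, fun _ => (expMod_congr ?_).symm⟩
    · have := QuadOrder.norm_add_mul_disc_modEq hm a z w
      rw [← dvd_add_right this]
      congr! 1
      ring
    · rw [add_mul, LinearMap.map_add, add_sub_cancel_left, mul_assoc _ w l]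
      exact QuadOrder.trace_natCast_mul_disc_mul hm a (w * l)
  · have hld : ¬ QuadOrder.disc m ∣ l := by
      intro h
      have h1 : IsUnit δ := hl.symm.isUnit_of_dvd' dvd_rfl (by
        rw [← hφδ]; exact map_dvd φ h)
      rw [← hφδ, MulEquiv.isUnit_map] at h1
      have h2 := h1.map QuadraticAlgebra.norm
      rw [QuadOrder.norm_disc, ← hm, IsUnit.neg_iff, Int.isUnit_iff_natAbs_eq,
        Int.natAbs_natCast] at h2
      exact hDp.out.one_lt.ne' h2
    have hS' : ∀ y, ∃! s, s ∈ S.map φ.symm.toEquiv.toEmbedding ∧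
        (a : QuadOrder m) * QuadOrder.disc m ∣ y - s := by
      intro y
      have hiff : ∀ s, (s ∈ S.map φ.symm.toEquiv.toEmbedding ∧
          (a : QuadOrder m) * QuadOrder.disc m ∣ y - s) ↔
          (φ s ∈ S ∧ (a : R) * δ ∣ φ y - φ s) := by
        intro s
        rw [Finset.mem_map_equiv, ← map_dvd_iff φ, map_mul, map_natCast, hφδ, map_sub]
        rfl
      simp_rw [hiff]
      obtain ⟨s, hs, huniq⟩ := hS (φ y)
      refine ⟨φ.symm s, by simpa using hs, fun t ht => ?_⟩
      rw [← huniq _ ht, RingEquiv.symm_apply_apply]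
    have hmain := QuadOrder.sum_expMod_trace_eq hD4 hm ha.ne' hld hS'
    rw [hNφ]
    have hfilter : ∀ r : ℕ, ((r : R) ∣ φ l) = ((r : QuadOrder m) ∣ l) := by
      intro r
      rw [← map_natCast φ, map_dvd_iff φ]
    simp_rw [hfilter]
    rw [← hmain]
    refine Finset.sum_equiv φ.symm.toEquiv (fun s => ?_) (fun s _ => ?_)
    · obtain ⟨z, rfl⟩ := φ.surjective s
      rw [Finset.mem_filter, Finset.mem_filter, hdvd, Finset.mem_map_equiv]
      simp
    · obtain ⟨z, rfl⟩ := φ.surjective s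
      rw [← map_mul, hTφ]
      simp [expMod]
end

section
/- Let H: ℝ → ℂ be continuously differentiable and integrable (H ∈ L¹(ℝ)). For each k ∈ ℝ the principal value PV∫_{−∞}^{∞} H(x)·e^{ikx}·(dx/x) := lim_{ε→0⁺} ∫_{|x| ≥ ε} H(x)·e^{ikx}·(dx/x) exists, and PV∫_{−∞}^{∞} H(x)·e^{ikx}·(dx/x) → π·i·H(0) as k → +∞, while PV∫_{−∞}^{∞} H(x)·e^{ikx}·(dx/x) → −π·i·H(0) as k → −∞. -/
open MeasureTheory Filter

theorem integrable_exp_neg_sq : Integrable fun x : ℝ => Real.exp (-x ^ 2) := by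
  simpa using integrable_exp_neg_mul_sq one_pos

theorem measurableSet_le_abs (ε : ℝ) : MeasurableSet {x : ℝ | ε ≤ |x|} :=
  measurableSet_le measurable_const measurable_norm

theorem integral_cos_mul_gaussian (t : ℝ) :
    ∫ x : ℝ, Real.exp (-x ^ 2) * Real.cos (t * x) =
      √Real.pi * Real.exp (-(1 / 4) * t ^ 2) := by
  have h := fourierIntegral_gaussian (b := 1) (by simp) (t : ℂ)
  have hint : Integrable fun x : ℝ =>
      Complex.exp (Complex.I * t * x) * Complex.exp (-1 * (x : ℂ) ^ 2) := by
    have := integrable_cexp_quadratic (b := 1) (by simp) (Complex.I * t) 0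
    refine this.congr (Eventually.of_forall fun x => ?_)
    simp only [← Complex.exp_add]
    congr 1
    ring
  have h2 := congrArg Complex.re h
  rw [← RCLike.re_eq_complex_re, ← integral_re hint] at h2
  have h3 : ((Real.pi : ℂ) / 1) ^ (1 / 2 : ℂ) * Complex.exp (-(t : ℂ) ^ 2 / (4 * 1)) =
      ((√Real.pi * Real.exp (-(1 / 4) * t ^ 2) : ℝ) : ℂ) := by
    rw [Real.sqrt_eq_rpow, div_one]
    push_cast [Complex.ofReal_cpow Real.pi_pos.le]
    congr 2
    ring
  rw [h3] at h2
  simp only [RCLike.re_eq_complex_re, Complex.ofReal_re] at h2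
  rw [← h2]
  congr 1 with x
  rw [← Complex.exp_add, Complex.exp_re]
  simp [← Complex.ofReal_pow]

theorem integral_gaussian_mul_sin_div (k : ℝ) :
    ∫ x : ℝ, Real.exp (-x ^ 2) * (Real.sin (k * x) / x) =
      √Real.pi * ∫ t in (0 : ℝ)..k, Real.exp (-(1 / 4) * t ^ 2) := by
  have : IsFiniteMeasure (volume.restrict (Set.uIoc 0 k)) := by
    unfold Set.uIoc; infer_instance
  have hint : Integrable (Function.uncurry fun t x : ℝ => Real.exp (-x ^ 2) * Real.cos (t * x))
      ((volume.restrict (Set.uIoc 0 k)).prod volume) := by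
    refine Integrable.mono' ((integrable_const (1 : ℝ)).mul_prod integrable_exp_neg_sq)
      (Continuous.aestronglyMeasurable (by unfold Function.uncurry; fun_prop))
      (Eventually.of_forall fun p => ?_)
    simp only [Function.uncurry, norm_mul, Real.norm_eq_abs, Real.abs_exp, one_mul]
    exact mul_le_of_le_one_right (Real.exp_pos _).le (Real.abs_cos_le_one _)
  rw [← intervalIntegral.integral_const_mul]
  simp_rw [← integral_cos_mul_gaussian]
  rw [intervalIntegral_integral_swap hint]
  refine integral_congr_ae ?_
  filter_upwards [Measure.ae_ne volume (0 : ℝ)] with x hx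
  rw [intervalIntegral.integral_const_mul, intervalIntegral.integral_comp_mul_right _ hx]
  simp [div_eq_inv_mul]

theorem tendsto_integral_gaussian_mul_sin_div_atTop :
    Tendsto (fun k : ℝ => ∫ x : ℝ, Real.exp (-x ^ 2) * (Real.sin (k * x) / x))
      atTop (nhds Real.pi) := by
  simp_rw [integral_gaussian_mul_sin_div]
  have h := (intervalIntegral_tendsto_integral_Ioi 0
    (integrable_exp_neg_mul_sq (b := 1 / 4) (by norm_num)).integrableOn tendsto_id).const_mul
      √Real.pi
  rw [integral_gaussian_Ioi] at h
  convert h using 2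
  · rfl
  rw [div_div_eq_mul_div, div_one, Real.sqrt_mul Real.pi_pos.le,
    show (4 : ℝ) = 2 ^ 2 by norm_num, Real.sqrt_sq two_pos.le]
  nlinarith [Real.mul_self_sqrt Real.pi_pos.le]

theorem tendsto_integral_gaussian_mul_sin_div_atBot :
    Tendsto (fun k : ℝ => ∫ x : ℝ, Real.exp (-x ^ 2) * (Real.sin (k * x) / x))
      atBot (nhds (-Real.pi)) := by
  refine (tendsto_integral_gaussian_mul_sin_div_atTop.comp tendsto_neg_atBot_atTop).neg.congr
    fun k => ?_
  simp [neg_div, integral_neg]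

theorem integrable_gaussian_mul_sin_div (k : ℝ) :
    Integrable fun x : ℝ => Real.exp (-x ^ 2) * (Real.sin (k * x) / x) := by
  refine integrable_exp_neg_sq.mul_bdd (c := |k|)
    (Measurable.aestronglyMeasurable (by fun_prop)) (Eventually.of_forall fun x => ?_)
  rw [Real.norm_eq_abs, abs_div]
  refine div_le_of_le_mul₀ (abs_nonneg _) (abs_nonneg _) ?_
  rw [← abs_mul]
  exact Real.abs_sin_le_abs

theorem tendsto_setIntegral_le_abs {E : Type*} [NormedAddCommGroup E] [NormedSpace ℝ E]
    {f : ℝ → E} (hf : Integrable f) :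
    Tendsto (fun ε : ℝ => ∫ x in {x : ℝ | ε ≤ |x|}, f x) (nhdsWithin 0 (Set.Ioi 0))
      (nhds (∫ x, f x)) := by
  simp_rw [← fun ε => integral_indicator (f := f) (μ := volume) (measurableSet_le_abs ε)]
  refine tendsto_integral_filter_of_dominated_convergence (fun x => ‖f x‖)
    (Eventually.of_forall fun ε => hf.aestronglyMeasurable.indicator (measurableSet_le_abs ε))
    (Eventually.of_forall fun ε => Eventually.of_forall fun x => norm_indicator_le_norm_self _ _)
    hf.norm ?_
  filter_upwards [Measure.ae_ne volume (0 : ℝ)] with x hx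
  refine tendsto_const_nhds.congr' ?_
  filter_upwards [nhdsWithin_le_nhds (Iio_mem_nhds (abs_pos.2 hx))] with ε hε
  have hx : x ∈ {x : ℝ | ε ≤ |x|} := (Set.mem_Iio.1 hε).le
  exact (Set.indicator_of_mem hx f).symm

theorem integrable_dslope_zero {f : ℝ → ℂ} (hf : Integrable f) (hc : Continuous f)
    (hd : DifferentiableAt ℝ f 0) (h0 : f 0 = 0) : Integrable (dslope f 0) := by
  have hcont : Continuous (dslope f 0) := by
    rw [← continuousOn_univ, continuousOn_dslope univ_mem]
    exact ⟨hc.continuousOn, hd⟩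
  rw [← integrableOn_univ, ← Set.union_compl_self (Set.Icc (-1 : ℝ) 1)]
  refine hcont.integrableOn_Icc.union ?_
  refine Integrable.mono' hf.norm.integrableOn hcont.aestronglyMeasurable ?_
  filter_upwards [ae_restrict_mem measurableSet_Icc.compl] with x hx
  have hx1 : 1 ≤ |x| := by
    by_contra! h
    exact hx (abs_le.1 h.le)
  have hx0 : x ≠ 0 := by
    rintro rfl
    norm_num at hx1
  rw [dslope_of_ne _ hx0, slope_def_module, h0, sub_zero, sub_zero, norm_smul, norm_inv,
    Real.norm_eq_abs]
  exact mul_le_of_le_one_left (norm_nonneg _) (inv_le_one_of_one_le₀ hx1)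

theorem tendsto_integral_mul_cexp_cocompact (f : ℝ → ℂ) :
    Tendsto (fun k : ℝ => ∫ x : ℝ, f x * Complex.exp (Complex.I * k * x))
      (cocompact ℝ) (nhds 0) := by
  have hne : (-(2 * Real.pi)⁻¹ : ℝ) ≠ 0 := by simp [Real.pi_ne_zero]
  have h := (Real.tendsto_integral_exp_smul_cocompact f).comp
    (Homeomorph.mulRight₀ _ hne).isClosedEmbedding.tendsto_cocompact
  refine h.congr fun k => ?_
  refine integral_congr_ae (Eventually.of_forall fun x => ?_)
  simp only [Homeomorph.coe_mulRight₀, Circle.smul_def, smul_eq_mul, Real.fourierChar_apply]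
  rw [mul_comm]
  congr 2
  push_cast
  have : (Real.pi : ℂ) ≠ 0 := by simp [Real.pi_ne_zero]
  field_simp

theorem setIntegral_le_abs_gaussian_mul_cos_div (ε k : ℝ) :
    ∫ x in {x : ℝ | ε ≤ |x|}, Real.exp (-x ^ 2) * (Real.cos (k * x) / x) = 0 := by
  rw [← integral_indicator (measurableSet_le_abs ε)]
  refine CharZero.eq_neg_self_iff.1 ?_
  rw [← integral_neg, ← integral_neg_eq_self]
  congr 1 with x
  by_cases hx : ε ≤ |x| <;> simp [Set.indicator, hx, div_neg]

theorem integrableOn_le_abs_gaussian_mul_cos_div {ε : ℝ} (hε : 0 < ε) (k : ℝ) :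
    IntegrableOn (fun x : ℝ => Real.exp (-x ^ 2) * (Real.cos (k * x) / x))
      {x : ℝ | ε ≤ |x|} := by
  refine integrable_exp_neg_sq.integrableOn.mul_bdd (c := ε⁻¹)
    (Measurable.aestronglyMeasurable (by fun_prop)) ?_
  filter_upwards [ae_restrict_mem (measurableSet_le_abs ε)] with x hx
  rw [Real.norm_eq_abs, abs_div, ← one_div]
  exact div_le_div₀ zero_le_one (Real.abs_cos_le_one _) hε hx

/-- Let `H : ℝ → ℂ` be continuously differentiable and integrable. Then for
each `k ∈ ℝ` the principal value `PV ∫ H(x)·e^{ikx}·dx/x`, i.e. the limit as `ε → 0⁺` of the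
integrals over `{|x| ≥ ε}`, exists; moreover it tends to `π·i·H(0)` as `k → +∞` and to
`−π·i·H(0)` as `k → −∞`. -/
theorem stmt_10 (H : ℝ → ℂ) (hH : ContDiff ℝ 1 H) (hHint : Integrable H) :
    ∃ PV : ℝ → ℂ,
      (∀ k : ℝ,
        Tendsto
          (fun ε : ℝ =>
            ∫ x in {x : ℝ | ε ≤ |x|}, H x * Complex.exp (Complex.I * (k : ℂ) * (x : ℂ)) / (x : ℂ))
          (nhdsWithin 0 (Set.Ioi 0)) (nhds (PV k))) ∧
      Tendsto PV atTop (nhds ((Real.pi : ℂ) * Complex.I * H 0)) ∧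
      Tendsto PV atBot (nhds (-((Real.pi : ℂ) * Complex.I * H 0))) := by
  let S : ℝ → ℝ := fun k => ∫ x : ℝ, Real.exp (-x ^ 2) * (Real.sin (k * x) / x)
  set f : ℝ → ℂ := fun x => H x - H 0 * ((Real.exp (-x ^ 2) : ℝ) : ℂ) with hf
  have hfint : Integrable f := hHint.sub (integrable_exp_neg_sq.ofReal.const_mul _)
  have hfd : Differentiable ℝ f := by
    have := hH.differentiable one_ne_zero
    have h2 : Differentiable ℝ fun x : ℝ => ((Real.exp (-x ^ 2) : ℝ) : ℂ) :=
      Complex.ofRealCLM.differentiable.comp (by fun_prop)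
    exact this.sub (h2.const_mul _)
  have hf0 : f 0 = 0 := by simp [hf]
  set D := dslope f 0
  have hD : Integrable D := integrable_dslope_zero hfint hfd.continuous (hfd 0) hf0
  have hDk (k : ℝ) : Integrable fun x : ℝ => D x * Complex.exp (Complex.I * k * x) := by
    refine hD.mul_bdd (c := 1) (Continuous.aestronglyMeasurable (by fun_prop))
      (Eventually.of_forall fun x => ?_)
    rw [Complex.norm_exp]
    simp
  refine ⟨fun k => (∫ x : ℝ, D x * Complex.exp (Complex.I * k * x)) + S k * Complex.I * H 0,
    fun k => ?_, ?_, ?_⟩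
  · have h1 := (tendsto_setIntegral_le_abs (hDk k)).add
      ((((Complex.continuous_ofReal.tendsto _).comp (tendsto_setIntegral_le_abs
        (integrable_gaussian_mul_sin_div k))).mul_const Complex.I).mul_const (H 0))
    refine h1.congr' ?_
    filter_upwards [self_mem_nhdsWithin] with ε hε
    have hcos : IntegrableOn
        (fun x : ℝ => ((Real.exp (-x ^ 2) * (Real.cos (k * x) / x) : ℝ) : ℂ))
        {x : ℝ | ε ≤ |x|} := (integrableOn_le_abs_gaussian_mul_cos_div hε k).ofReal
    have hsin : IntegrableOn
        (fun x : ℝ => ((Real.exp (-x ^ 2) * (Real.sin (k * x) / x) : ℝ) : ℂ))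
        {x : ℝ | ε ≤ |x|} := (integrable_gaussian_mul_sin_div k).integrableOn.ofReal
    have hzero : ∫ x in {x : ℝ | ε ≤ |x|},
        ((Real.exp (-x ^ 2) * (Real.cos (k * x) / x) : ℝ) : ℂ) = 0 := by
      rw [integral_complex_ofReal, setIntegral_le_abs_gaussian_mul_cos_div, Complex.ofReal_zero]
    have hsplit : ∀ x ∈ {x : ℝ | ε ≤ |x|},
        H x * Complex.exp (Complex.I * (k : ℂ) * (x : ℂ)) / (x : ℂ) =
        D x * Complex.exp (Complex.I * k * x) +
          (((Real.exp (-x ^ 2) * (Real.sin (k * x) / x) : ℝ) : ℂ) * Complex.I * H 0 +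
          ((Real.exp (-x ^ 2) * (Real.cos (k * x) / x) : ℝ) : ℂ) * H 0) := by
      intro x hx
      have hx0 : x ≠ 0 := abs_pos.1 (lt_of_lt_of_le hε hx)
      have hxc : (x : ℂ) ≠ 0 := Complex.ofReal_ne_zero.2 hx0
      have hexp : Complex.exp (Complex.I * k * x) =
          Complex.cos (k * x) + Complex.sin (k * x) * Complex.I := by
        rw [← Complex.exp_mul_I]
        ring_nf
      have hDx : D x = (x : ℂ)⁻¹ * f x := by
        simp only [D]
        rw [dslope_of_ne _ hx0, slope_def_module, hf0, sub_zero, sub_zero, Complex.real_smul,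
          Complex.ofReal_inv]
      rw [hDx, hexp]
      simp only [hf]
      push_cast
      field_simp
      ring
    have hsin' := (hsin.mul_const Complex.I).mul_const (H 0)
    have hcos' := hcos.mul_const (H 0)
    rw [setIntegral_congr_fun (measurableSet_le_abs ε) hsplit,
      integral_add (hDk k).integrableOn (by exact hsin'.add hcos'), integral_add hsin' hcos',
      integral_mul_const, integral_mul_const, integral_mul_const, hzero, zero_mul, add_zero,
      integral_complex_ofReal]
    rfl
  · have h1 := ((tendsto_integral_mul_cexp_cocompact D).mono_left atTop_le_cocompact).add
      ((((Complex.continuous_ofReal.tendsto _).comp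
        tendsto_integral_gaussian_mul_sin_div_atTop).mul_const Complex.I).mul_const (H 0))
    simpa using h1
  · have h1 := ((tendsto_integral_mul_cexp_cocompact D).mono_left atBot_le_cocompact).add
      ((((Complex.continuous_ofReal.tendsto _).comp
        tendsto_integral_gaussian_mul_sin_div_atBot).mul_const Complex.I).mul_const (H 0))
    simpa using h1
end
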